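/- arXiv:math/0406165 — 2 statements merged into one kernel-verified Lean document; each statement's English description precedes it below -/
import Mathlib

section
/- Let (R,m) be a noetherian local ring, I a proper ideal of R, n ≥ 1 a natural number with H^j_I(R) = 0 for all j ≥ n+1, and f_1, …, f_n ∈ I. Then √I = √((f_1,…,f_n)R) if and only if for each i = 1, …, n, multiplication by f_i on H^{n+1-i}_I(R/(f_1,…,f_{i-1})R) is surjective. -/
/-- The underlying `R`-module of the `i`-th local cohomology of the `R`-module `M`
with support in the ideal `I`. -/
noncomputable abbrev LocalCohomologyModule {R : Type} [CommRing R] (I : Ideal R) (i : ℕ)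
    (M : Type) [AddCommGroup M] [Module R M] : ModuleCat R :=
  (localCohomology I i).obj (ModuleCat.of R M)

section
open CategoryTheory Limits Opposite

namespace HomologicalComplex
variable {V ι : Type*} [Category* V] [HasZeroMorphisms V] {c : ComplexShape ι}
  {K L : HomologicalComplex Vᵒᵖ c}

lemma homologyUnop_inv_naturality (ψ : K ⟶ L) (i : ι) [K.HasHomology i] [L.HasHomology i] :
    (homologyMap ψ i).unop ≫ (K.homologyUnop i).inv =
      (L.homologyUnop i).inv ≫ homologyMap ((unopFunctor V c).map ψ.op) i := by
  have h : (L.homologyUnop i).hom ≫ (homologyMap ψ i).unop =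
      homologyMap ((unopFunctor V c).map ψ.op) i ≫ (K.homologyUnop i).hom :=
    congrArg Quiver.Hom.unop (homologyOp_hom_naturality ((unopFunctor V c).map ψ.op) i)
  exact (Iso.eq_inv_comp _).2 ((Category.assoc _ _ _).symm.trans ((Iso.comp_inv_eq _).2 h))

end HomologicalComplex

namespace CategoryTheory.ProjectiveResolution
universe u v
variable {R : Type u} [CommRing R] {C : Type v} [Category.{u} C] [Abelian C] [Linear R C]
  {X X' : C} {P : ProjectiveResolution X} {P' : ProjectiveResolution X'}

lemma unop_square_paste {D : Type*} [Category* D] {A B A' B' : Dᵒᵖ} {M M' : D}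
    {a : B ⟶ A} {a' : B' ⟶ A'} {m : A' ⟶ A} {l : B' ⟶ B}
    {t : M ⟶ M'} {u : B.unop ⟶ M} {u' : B'.unop ⟶ M'} (h : a' ≫ m = l ≫ a)
    (k : l.unop ≫ u' = u ≫ t) :
    m.unop ≫ a'.unop ≫ u' = (a.unop ≫ u) ≫ t := by
  rw [Category.assoc, ← k, ← Category.assoc, ← Category.assoc, ← unop_comp, ← unop_comp, h]

/-- The map on complexes `Hom(-, Y)` induced by a chain map of projective resolutions. -/
noncomputable def linearYonedaMap (φ : P'.complex ⟶ P.complex) (Y : C) :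
    P.complex.linearYonedaObj R Y ⟶ P'.complex.linearYonedaObj R Y :=
  (HomologicalComplex.unopFunctor _ _).map
    ((((linearYoneda R C).obj Y).rightOp.mapHomologicalComplex _).map φ).op

lemma isoExt_hom_naturality [EnoughProjectives C] {g : X' ⟶ X} (φ : Hom P' P g) (Y : C) (n : ℕ) :
    ((Ext R C n).map g.op).app Y ≫ (P'.isoExt n Y).hom =
      (P.isoExt n Y).hom ≫ HomologicalComplex.homologyMap (linearYonedaMap φ.hom Y) n := by
  have h : _ = HomologicalComplex.homologyMap _ n ≫ _ :=
    isoLeftDerivedObj_inv_naturality g P' P φ.hom (by simpa using φ.hom_f_zero_comp_π_f_zero)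
      (((linearYoneda R C).obj Y).rightOp) n
  exact unop_square_paste h (HomologicalComplex.homologyUnop_inv_naturality
    ((((linearYoneda R C).obj Y).rightOp.mapHomologicalComplex (ComplexShape.down ℕ)).map φ.hom) n)

variable (R P) in
/-- The submodule of `n`-cocycles in `Hom(P, Y)`. -/
def cocycles (Y : C) (n : ℕ) : Submodule R (P.complex.X n ⟶ Y) where
  carrier := {f | P.complex.d (n + 1) n ≫ f = 0}
  add_mem' hf hg := by simp_all
  zero_mem' := by simp
  smul_mem' r f hf := by simp_all

variable (R P) in
/-- A cycle of the complex `Hom(P, Y)`, viewed as a cocycle. -/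
noncomputable def cyclesToCocycles (Y : C) (n : ℕ) :
    (P.complex.linearYonedaObj R Y).cycles n →ₗ[R] P.cocycles R Y n :=
  LinearMap.codRestrict (P.cocycles R Y n) ((P.complex.linearYonedaObj R Y).iCycles n).hom
    fun c => by
      have h := congrArg (fun t => t.hom c) ((P.complex.linearYonedaObj R Y).iCycles_d n (n + 1))
      exact h

lemma cyclesToCocycles_surjective (Y : C) (n : ℕ) :
    Function.Surjective (P.cyclesToCocycles R Y n) := by
  rintro ⟨f, hf⟩
  exact ⟨(P.complex.linearYonedaObj R Y).cyclesMk (i := n) f (n + 1) (by simp) hf,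
    Subtype.ext ((P.complex.linearYonedaObj R Y).i_cyclesMk f (n + 1) (by simp) hf)⟩

lemma cyclesToCocycles_cyclesMap {g : X' ⟶ X} (φ : Hom P' P g) (Y : C) (n : ℕ)
    (c : (P.complex.linearYonedaObj R Y).cycles n) :
    (P'.cyclesToCocycles R Y n
      (HomologicalComplex.cyclesMap (linearYonedaMap φ.hom Y) n c)).1 =
      φ.hom.f n ≫ (P.cyclesToCocycles R Y n c).1 := by
  have h' := congrArg (fun t => t.hom c)
    (HomologicalComplex.cyclesMap_i (linearYonedaMap (R := R) φ.hom Y) n)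
  exact h'

variable [HasExt.{u} C]

variable (R P) in
/-- The `Ext` class of a cocycle. -/
noncomputable def cocyclesToExt (Y : C) (n : ℕ) :
    P.cocycles R Y n →ₗ[R] Abelian.Ext X Y n where
  toFun c := P.extMk c.1 (n + 1) rfl c.2
  map_add' c c' := (P.add_extMk _ _ _ _ _ _).symm
  map_smul' r c := by
    rw [RingHom.id_apply, Abelian.Ext.smul_eq_comp_mk₀]
    refine Eq.trans ?_ (extMk_comp_mk₀ _ c.1 (n + 1) rfl c.2 (r • 𝟙 Y)).symm
    congr 1
    simp

lemma cocyclesToExt_surjective (Y : C) (n : ℕ) :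
    Function.Surjective (P.cocyclesToExt R Y n) := by
  intro α
  obtain ⟨f, hf, rfl⟩ := P.extMk_surjective α (n + 1) rfl
  exact ⟨⟨f, hf⟩, rfl⟩

lemma cocyclesToExt_cyclesToCocycles_eq_zero_iff (Y : C) (n : ℕ)
    (c : (P.complex.linearYonedaObj R Y).cycles (n + 1)) :
    P.cocyclesToExt R Y (n + 1) (P.cyclesToCocycles R Y (n + 1) c) = 0 ↔
      ∃ g, (P.complex.linearYonedaObj R Y).toCycles n (n + 1) g = c := by
  let K := P.complex.linearYonedaObj R Y
  refine (P.extMk_eq_zero_iff _ (n + 2) rfl (P.cyclesToCocycles R Y (n + 1) c).2 n rfl).trans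
    (exists_congr fun g => ?_)
  have hinj : Function.Injective (K.iCycles (n + 1)) :=
    (ModuleCat.mono_iff_injective _).1 inferInstance
  have h : K.iCycles (n + 1) (K.toCycles n (n + 1) g) = K.d n (n + 1) g :=
    congrArg (fun t => t.hom g) (K.toCycles_i n (n + 1))
  refine Iff.trans ?_ hinj.eq_iff
  rw [h]
  rfl

variable (R P) in
/-- The factorization of the map from cycles of `Hom(P, Y)` to `Abelian.Ext` through homology. -/
noncomputable def homologyDesc (Y : C) (n : ℕ) :=
  CokernelCofork.IsColimit.desc'
    ((P.complex.linearYonedaObj R Y).homologyIsCokernel n (n + 1) (by simp))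
    (ModuleCat.ofHom (P.cocyclesToExt R Y (n + 1) ∘ₗ P.cyclesToCocycles R Y (n + 1)))
    (by
      ext g
      exact (P.cocyclesToExt_cyclesToCocycles_eq_zero_iff Y n _).2 ⟨g, rfl⟩)

variable (R P) in
/-- The comparison map from the homology of `Hom(P, Y)` to `Abelian.Ext`. -/
noncomputable def homologyToExt (Y : C) (n : ℕ) :
    (P.complex.linearYonedaObj R Y).homology (n + 1) ⟶ ModuleCat.of R (Abelian.Ext X Y (n + 1)) :=
  (P.homologyDesc R Y n).1

lemma homologyToExt_homologyπ (Y : C) (n : ℕ)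
    (c : (P.complex.linearYonedaObj R Y).cycles (n + 1)) :
    P.homologyToExt R Y n ((P.complex.linearYonedaObj R Y).homologyπ (n + 1) c) =
      P.cocyclesToExt R Y (n + 1) (P.cyclesToCocycles R Y (n + 1) c) := by
  have h := congrArg (fun t => t.hom c) (P.homologyDesc R Y n).2
  exact h

lemma homologyπ_surjective (K : CochainComplex (ModuleCat.{u} R) ℕ) (n : ℕ) :
    Function.Surjective (K.homologyπ n) :=
  (ModuleCat.epi_iff_surjective _).1 inferInstance

lemma homologyToExt_bijective (Y : C) (n : ℕ) :
    Function.Bijective (P.homologyToExt R Y n) := by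
  constructor
  · rw [injective_iff_map_eq_zero]
    intro z hz
    obtain ⟨c, rfl⟩ := homologyπ_surjective _ _ z
    rw [homologyToExt_homologyπ, cocyclesToExt_cyclesToCocycles_eq_zero_iff] at hz
    obtain ⟨g, rfl⟩ := hz
    exact congrArg (fun t => t.hom g)
      ((P.complex.linearYonedaObj R Y).toCycles_comp_homologyπ n (n + 1))
  · intro α
    obtain ⟨f, rfl⟩ := cocyclesToExt_surjective (P := P) (R := R) Y _ α
    obtain ⟨c, rfl⟩ := cyclesToCocycles_surjective (P := P) Y _ f
    exact ⟨_, homologyToExt_homologyπ Y n c⟩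

lemma cocyclesToExt_naturality {g : X' ⟶ X} (φ : Hom P' P g) (Y : C) (n : ℕ)
    (c : P.cocycles R Y n) (c' : P'.cocycles R Y n) (h : c'.1 = φ.hom.f n ≫ c.1) :
    P'.cocyclesToExt R Y n c' =
      (Abelian.Ext.mk₀ g).comp (P.cocyclesToExt R Y n c) (zero_add _) := by
  obtain ⟨c', hc'⟩ := c'
  obtain rfl : c' = _ := h
  exact (mk₀_comp_extMk _ (n + 1) rfl c.2 φ).symm

lemma homologyToExt_naturality {g : X' ⟶ X} (φ : Hom P' P g) (Y : C) (n : ℕ)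
    (z : (P.complex.linearYonedaObj R Y).homology (n + 1)) :
    P'.homologyToExt R Y n (HomologicalComplex.homologyMap (linearYonedaMap φ.hom Y) (n + 1) z) =
      (Abelian.Ext.mk₀ g).comp (P.homologyToExt R Y n z) (zero_add _) := by
  obtain ⟨c, rfl⟩ := homologyπ_surjective _ _ z
  have h := congrArg (fun t => t.hom c)
    (HomologicalComplex.homologyπ_naturality (linearYonedaMap (R := R) φ.hom Y) (n + 1))
  refine (congrArg _ h).trans ?_
  refine (homologyToExt_homologyπ Y n _).trans ?_
  rw [homologyToExt_homologyπ]
  exact cocyclesToExt_naturality φ Y _ _ _ (cyclesToCocycles_cyclesMap φ Y _ c)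

variable [EnoughProjectives C]

variable (R) in
/-- The derived functor `Ext` agrees with `Abelian.Ext` in positive degrees. -/
noncomputable def extIso (X Y : C) (n : ℕ) :
    ((_root_.Ext R C (n + 1)).obj (op X)).obj Y ≃ₗ[R] Abelian.Ext X Y (n + 1) :=
  ((projectiveResolution X).isoExt (n + 1) Y).toLinearEquiv ≪≫ₗ
    LinearEquiv.ofBijective ((projectiveResolution X).homologyToExt R Y n).hom
      (homologyToExt_bijective Y n)

lemma extIso_naturality (g : X' ⟶ X) (Y : C) (n : ℕ)
    (z : ((_root_.Ext R C (n + 1)).obj (op X)).obj Y) :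
    extIso R X' Y n (((_root_.Ext R C (n + 1)).map g.op).app Y z) =
      (Abelian.Ext.mk₀ g).comp (extIso R X Y n z) (zero_add _) := by
  obtain ⟨φ⟩ : Nonempty (Hom (projectiveResolution X') (projectiveResolution X) g) :=
    ⟨⟨lift g _ _,
      (lift_commutes_zero g _ _).trans (by simp)⟩⟩
  refine Eq.trans ?_ (homologyToExt_naturality φ Y n _)
  exact congrArg _ (congrArg (fun t => t.hom z) (isoExt_hom_naturality (R := R) φ Y (n + 1)))

end CategoryTheory.ProjectiveResolution

namespace CategoryTheory.ShortComplex.ShortExact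
open Abelian
universe w v u
variable {C : Type u} [Category.{v} C] [Abelian C] [HasExt.{w} C]

/-- Dimension shifting for the vanishing of the action of a morphism on `Ext`. -/
lemma mk₀_comp_eq_zero_of_projective {S S' : ShortComplex C} (hS : S.ShortExact)
    (hS' : S'.ShortExact) (φ : S ⟶ S') [Projective S'.X₂] {Y : C} {n : ℕ}
    (h : ∀ e : Ext S'.X₁ Y n, (Ext.mk₀ φ.τ₁).comp e (zero_add n) = 0)
    (e : Ext S'.X₃ Y (n + 1)) : (Ext.mk₀ φ.τ₃).comp e (zero_add (n + 1)) = 0 := by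
  obtain ⟨e, rfl⟩ := Ext.contravariant_sequence_exact₃ hS' Y e (Ext.eq_zero_of_projective _)
    (add_comm 1 n)
  rw [← Ext.comp_assoc _ _ _ (zero_add 1) (add_comm 1 n) (by lia),
    ← extClass_naturality hS hS' φ, Ext.comp_assoc _ _ _ _ (zero_add n) (by lia), h, Ext.comp_zero]

end CategoryTheory.ShortComplex.ShortExact

namespace ModuleCat
universe u
variable {R : Type u} [CommRing R]
open Abelian

/-- If `M` is killed by a power of `I`, then any morphism to a finite module `N` with image in a
sufficiently high `I ^ u N` induces zero on `Ext(-, M)`. -/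
lemma exists_pow_mk₀_comp_eq_zero [IsNoetherianRing R] {I : Ideal R} {s : ℕ} (M : ModuleCat.{u} R)
    (hM : I ^ s ≤ Module.annihilator R M) (j : ℕ) (N : ModuleCat.{u} R) [Module.Finite R N] :
    ∃ u : ℕ, ∀ (N' : ModuleCat.{u} R) (g : N' ⟶ N),
      LinearMap.range g.hom ≤ I ^ u • (⊤ : Submodule R N) →
        ∀ e : Ext N M j, (Ext.mk₀ g).comp e (zero_add j) = 0 := by
  induction j generalizing N with
  | zero =>
    refine ⟨s, fun N' g hg e => ?_⟩
    obtain ⟨e, rfl⟩ := Ext.homEquiv₀.symm.surjective e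
    have h0 : g ≫ e = 0 := by
      ext x
      have hx : g.hom x ∈ I ^ s • (⊤ : Submodule R N) := hg ⟨x, rfl⟩
      have h1 : (I ^ s • (⊤ : Submodule R N)).map e.hom ≤ ⊥ := by
        rw [Submodule.map_smul'', Submodule.smul_le]
        intro r hr y _
        exact (Submodule.mem_bot R).2 (Module.mem_annihilator.1 (hM hr) y)
      exact (Submodule.mem_bot R).1 (h1 ⟨_, hx, rfl⟩)
    refine (Ext.mk₀_comp_mk₀ g e).trans ?_
    rw [h0, Ext.mk₀_zero]
  | succ j ih =>
    obtain ⟨m, π, hπ⟩ := Module.Finite.exists_fin' R N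
    have hS := LinearMap.shortExact_shortComplexKer hπ
    obtain ⟨u, hu⟩ := ih (ModuleCat.of R (LinearMap.ker π))
    obtain ⟨k, hk⟩ := Ideal.exists_pow_inf_eq_pow_smul I (LinearMap.ker π)
    refine ⟨u + k, fun N' g hg e => ?_⟩
    have hlift : ∀ x : N', ∃ y : Fin m → R, y ∈ I ^ (u + k) • (⊤ : Submodule R (Fin m → R)) ∧
        π y = g.hom x := by
      intro x
      have hx := hg ⟨x, rfl⟩
      rw [← LinearMap.range_eq_top.2 hπ, LinearMap.range_eq_map, ← Submodule.map_smul''] at hx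
      exact hx
    choose y hy hy' using hlift
    let π' : (N' →₀ R) →ₗ[R] N' := Finsupp.linearCombination R id
    let p : (N' →₀ R) →ₗ[R] (Fin m → R) := Finsupp.linearCombination R y
    have hp : ∀ z, p z ∈ I ^ (u + k) • (⊤ : Submodule R (Fin m → R)) := fun z =>
      Submodule.sum_mem _ fun x _ => Submodule.smul_mem _ _ (hy x)
    have hpπ : π ∘ₗ p = g.hom ∘ₗ π' := by
      ext x
      simp [p, π', hy']
    have hπ' : Function.Surjective π' := fun x => ⟨Finsupp.single x 1, by simp [π']⟩
    have hS' := LinearMap.shortExact_shortComplexKer hπ'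
    let q : LinearMap.ker π' →ₗ[R] LinearMap.ker π :=
      p.restrict fun z hz => by
        have := LinearMap.congr_fun hpπ z
        rw [LinearMap.mem_ker] at hz ⊢
        simpa [hz] using this
    let φ : π'.shortComplexKer ⟶ π.shortComplexKer :=
      { τ₁ := ModuleCat.ofHom q
        τ₂ := ModuleCat.ofHom p
        τ₃ := g
        comm₁₂ := rfl
        comm₂₃ := by
          ext1
          exact hpπ }
    have : Projective π.shortComplexKer.X₂ :=
      inferInstanceAs (Projective (ModuleCat.of R (Fin m → R)))
    refine hS'.mk₀_comp_eq_zero_of_projective hS φ (fun e' => hu _ _ ?_ e') e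
    rintro _ ⟨z, rfl⟩
    have hz : p z ∈ (I ^ (u + k) • (⊤ : Submodule R (Fin m → R))) ⊓ LinearMap.ker π :=
      ⟨hp z, (q z).2⟩
    rw [hk _ (by lia), Nat.add_sub_cancel] at hz
    have hz' : p z ∈ (I ^ u • (⊤ : Submodule R (LinearMap.ker π))).map
        (LinearMap.ker π).subtype := by
      rw [Submodule.map_smul'', Submodule.map_top, Submodule.range_subtype]
      exact Submodule.smul_mono le_rfl inf_le_right hz
    obtain ⟨w, hw, hw'⟩ := hz'
    obtain rfl : w = q z := Subtype.ext hw'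
    exact hw

end ModuleCat

namespace localCohomology
open CategoryTheory.Abelian
universe u
variable {R : Type u} [CommRing R] (I : Ideal R)

/-- The projection `R / I ^ s ⟶ R / I ^ t` for `t ≤ s`. -/
noncomputable abbrev powProj {t s : ℕ} (h : t ≤ s) :
    ModuleCat.of R (R ⧸ I ^ s) ⟶ ModuleCat.of R (R ⧸ I ^ t) :=
  ModuleCat.ofHom (Submodule.mapQ _ _ LinearMap.id (Ideal.pow_le_pow_right h))

lemma powProj_comp {t s r : ℕ} (h : t ≤ s) (h' : s ≤ r) :
    powProj I h' ≫ powProj I h = powProj I (h.trans h') := by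
  ext
  rfl

/-- Restriction of `Ext` classes along `R / I ^ s ⟶ R / I ^ t`. -/
noncomputable def res {M : ModuleCat.{u} R} {m t s : ℕ} (h : t ≤ s) :
    Ext (ModuleCat.of R (R ⧸ I ^ t)) M m →ₗ[R] Ext (ModuleCat.of R (R ⧸ I ^ s)) M m where
  toFun e := (Ext.mk₀ (powProj I h)).comp e (zero_add m)
  map_add' _ _ := Ext.comp_add _ _ _ _
  map_smul' _ _ := Ext.comp_smul _ _ _ _

variable {I} {M N : ModuleCat.{u} R} {m t s r : ℕ}

lemma res_res (h : t ≤ s) (h' : s ≤ r) (e : Ext (ModuleCat.of R (R ⧸ I ^ t)) M m) :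
    res I h' (res I h e) = res I (h.trans h') e := by
  refine (Ext.mk₀_comp_mk₀_assoc _ _ e).trans ?_
  rw [powProj_comp]
  rfl

lemma res_comp (h : t ≤ s) (e : Ext (ModuleCat.of R (R ⧸ I ^ t)) M m) {k l : ℕ}
    (e' : Ext M N k) (hl : m + k = l) :
    res I h (e.comp e' hl) = (res I h e).comp e' hl :=
  (Ext.comp_assoc _ _ _ (zero_add m) hl (by lia)).symm

variable (I) in
/-- Every class in `Ext^m(R / I ^ t, M)` vanishes on some `R / I ^ s`, `t ≤ s`; that is, the
`m`-th local cohomology of `M` vanishes. -/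
def ExtVanishes (m : ℕ) (M : ModuleCat.{u} R) : Prop :=
  ∀ (t : ℕ) (e : Ext (ModuleCat.of R (R ⧸ I ^ t)) M m), ∃ (s : ℕ) (h : t ≤ s), res I h e = 0

section ShortExact
variable {S : ShortComplex (ModuleCat.{u} R)} (hS : S.ShortExact)
include hS

lemma exists_res_eq_comp_f (hV : ExtVanishes I m S.X₃)
    (e : Ext (ModuleCat.of R (R ⧸ I ^ t)) S.X₂ m) :
    ∃ (s : ℕ) (h : t ≤ s) (e₁ : Ext (ModuleCat.of R (R ⧸ I ^ s)) S.X₁ m),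
      e₁.comp (Ext.mk₀ S.f) (add_zero m) = res I h e := by
  obtain ⟨s, h, hs⟩ := hV t (e.comp (Ext.mk₀ S.g) (add_zero m))
  rw [res_comp] at hs
  exact ⟨s, h, Ext.covariant_sequence_exact₂ _ hS _ hs⟩

lemma exists_res_eq_comp_g (hV : ExtVanishes I (m + 1) S.X₁)
    (e : Ext (ModuleCat.of R (R ⧸ I ^ t)) S.X₃ m) :
    ∃ (s : ℕ) (h : t ≤ s) (e₂ : Ext (ModuleCat.of R (R ⧸ I ^ s)) S.X₂ m),
      e₂.comp (Ext.mk₀ S.g) (add_zero m) = res I h e := by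
  obtain ⟨s, h, hs⟩ := hV t (e.comp hS.extClass rfl)
  rw [res_comp] at hs
  exact ⟨s, h, Ext.covariant_sequence_exact₃ _ hS _ rfl hs⟩

lemma ExtVanishes.middle (h₁ : ExtVanishes I m S.X₁) (h₃ : ExtVanishes I m S.X₃) :
    ExtVanishes I m S.X₂ := by
  intro t e
  obtain ⟨s, hs, e₁, he₁⟩ := exists_res_eq_comp_f hS h₃ e
  obtain ⟨r, hr, he⟩ := h₁ s e₁
  exact ⟨r, hs.trans hr, by rw [← res_res hs hr, ← he₁, res_comp, he, Ext.zero_comp]⟩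

lemma ExtVanishes.right (h₂ : ExtVanishes I m S.X₂) (h₁ : ExtVanishes I (m + 1) S.X₁) :
    ExtVanishes I m S.X₃ := by
  intro t e
  obtain ⟨s, hs, e₂, he₂⟩ := exists_res_eq_comp_g hS h₁ e
  obtain ⟨r, hr, he⟩ := h₂ s e₂
  exact ⟨r, hs.trans hr, by rw [← res_res hs hr, ← he₂, res_comp, he, Ext.zero_comp]⟩

end ShortExact

lemma ExtVanishes.of_subsingleton (I : Ideal R) (m : ℕ) (M : ModuleCat.{u} R) [Subsingleton M] :
    ExtVanishes I m M := by
  intro t e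
  refine ⟨t, le_rfl, ?_⟩
  have hM : 𝟙 M = 0 := (ModuleCat.isZero_of_subsingleton M).eq_of_src _ _
  rw [← Ext.comp_mk₀_id e, hM, Ext.mk₀_zero, Ext.comp_zero, map_zero]

/-- Modules killed by a power of `I` have vanishing local cohomology in positive degrees. -/
lemma ExtVanishes.of_pow_le_annihilator [IsNoetherianRing R] {M : ModuleCat.{u} R} {k : ℕ}
    (hM : I ^ k ≤ Module.annihilator R M) (m : ℕ) : ExtVanishes I (m + 1) M := by
  intro t e
  obtain ⟨u, hu⟩ := ModuleCat.exists_pow_mk₀_comp_eq_zero M hM m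
    (ModuleCat.of R (LinearMap.ker (I ^ t).mkQ))
  have hS (n : ℕ) := LinearMap.shortExact_shortComplexKer (I ^ n).mkQ_surjective
  have hle : I ^ (u + t) ≤ I ^ t := Ideal.pow_le_pow_right (by lia)
  let φ : (I ^ (u + t)).mkQ.shortComplexKer ⟶ (I ^ t).mkQ.shortComplexKer :=
    { τ₁ := ModuleCat.ofHom (Submodule.inclusion (by simpa using hle))
      τ₂ := 𝟙 _
      τ₃ := powProj I (by lia) }
  have : Projective (I ^ t).mkQ.shortComplexKer.X₂ :=
    inferInstanceAs (Projective (ModuleCat.of R R))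
  refine ⟨u + t, by lia, (hS _).mk₀_comp_eq_zero_of_projective (hS _) φ (fun e' => hu _ _ ?_ e') e⟩
  rintro _ ⟨⟨z, hz⟩, rfl⟩
  have hz' : z ∈ (I ^ u • (⊤ : Submodule R (LinearMap.ker (I ^ t).mkQ))).map
      (LinearMap.ker (I ^ t).mkQ).subtype := by
    rw [Submodule.map_smul'', Submodule.map_top, Submodule.range_subtype, Submodule.ker_mkQ,
      smul_eq_mul, ← pow_add]
    simpa using hz
  obtain ⟨w, hw, hw'⟩ := hz'
  have h : w = φ.τ₁.hom ⟨z, hz⟩ := Subtype.ext hw'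
  exact h ▸ hw

end localCohomology

namespace localCohomology
open CategoryTheory.Abelian
universe u
variable {R : Type u} [CommRing R] {I : Ideal R}

section Smul
variable (M : Type u) [AddCommGroup M] [Module R M] (r : R)

/-- Multiplication by `r` on `M`, as a map onto its image `r M = ker (M → M / r M)`. -/
def smulToKer : M →ₗ[R] LinearMap.ker (LinearMap.range (LinearMap.lsmul R M r)).mkQ :=
  (LinearMap.lsmul R M r).codRestrict _ fun x => by simp

lemma smulToKer_surjective : Function.Surjective (smulToKer M r) := by
  rintro ⟨z, hz⟩
  rw [Submodule.ker_mkQ] at hz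
  obtain ⟨x, rfl⟩ := hz
  exact ⟨x, rfl⟩

variable {M r} {m t : ℕ}

lemma comp_smulToKer_comp {X : ModuleCat.{u} R} (e : Ext X (ModuleCat.of R M) m) :
    (e.comp (Ext.mk₀ (smulToKer M r).shortComplexKer.g) (add_zero m)).comp
      (Ext.mk₀ (LinearMap.range (LinearMap.lsmul R M r)).mkQ.shortComplexKer.f) (add_zero m) =
        r • e := by
  rw [Ext.smul_eq_comp_mk₀, Ext.comp_assoc_of_third_deg_zero, Ext.mk₀_comp_mk₀]
  rfl

lemma exists_res_eq_smul
    (hC : ExtVanishes I m (ModuleCat.of R (M ⧸ LinearMap.range (LinearMap.lsmul R M r))))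
    (hK : ExtVanishes I (m + 1) (ModuleCat.of R (LinearMap.ker (smulToKer M r))))
    (e : Ext (ModuleCat.of R (R ⧸ I ^ t)) (ModuleCat.of R M) m) :
    ∃ (s : ℕ) (h : t ≤ s) (e' : Ext (ModuleCat.of R (R ⧸ I ^ s)) (ModuleCat.of R M) m),
      res I h e = r • e' := by
  obtain ⟨s, hs, e₁, he₁⟩ := exists_res_eq_comp_f
    (LinearMap.shortExact_shortComplexKer (Submodule.mkQ_surjective _)) hC e
  obtain ⟨s', hs', e', he'⟩ := exists_res_eq_comp_g
    (LinearMap.shortExact_shortComplexKer (smulToKer_surjective M r)) hK e₁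
  refine ⟨s', hs.trans hs', e', ?_⟩
  rw [← res_res hs hs', ← he₁, res_comp, ← comp_smulToKer_comp]
  exact congrArg (fun x => Ext.comp x _ _) he'.symm

lemma exists_res_eq_zero_of_smul_eq_zero
    (hC : ExtVanishes I m (ModuleCat.of R (M ⧸ LinearMap.range (LinearMap.lsmul R M r))))
    (hK : ExtVanishes I (m + 1) (ModuleCat.of R (LinearMap.ker (smulToKer M r))))
    (e : Ext (ModuleCat.of R (R ⧸ I ^ t)) (ModuleCat.of R M) (m + 1)) (he : r • e = 0) :
    ∃ (s : ℕ) (h : t ≤ s), res I h e = 0 := by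
  have hS := LinearMap.shortExact_shortComplexKer
    (Submodule.mkQ_surjective (LinearMap.range (LinearMap.lsmul R M r)))
  obtain ⟨c, hc⟩ := Ext.covariant_sequence_exact₁ _ hS _ ((comp_smulToKer_comp e).trans he) rfl
  obtain ⟨s, hs, hc'⟩ := hC t c
  have h : (res I hs e).comp (Ext.mk₀ (smulToKer M r).shortComplexKer.g) (add_zero _) = 0 := by
    rw [← res_comp, ← hc, res_comp, hc', Ext.zero_comp]
  obtain ⟨k, hk⟩ := Ext.covariant_sequence_exact₂ _
    (LinearMap.shortExact_shortComplexKer (smulToKer_surjective M r)) _ h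
  obtain ⟨s', hs', hk'⟩ := hK s k
  refine ⟨s', hs.trans hs', ?_⟩
  rw [← res_res hs hs', ← hk, res_comp, hk', Ext.zero_comp]

variable (M r)

lemma annihilator_le_annihilator_ker_smulToKer :
    Module.annihilator R M ≤ Module.annihilator R (LinearMap.ker (smulToKer M r)) :=
  LinearMap.annihilator_le_of_injective _ (Submodule.injective_subtype _)

lemma mem_annihilator_ker_smulToKer :
    r ∈ Module.annihilator R (LinearMap.ker (smulToKer M r)) :=
  Module.mem_annihilator.2 fun x => by
    have h : smulToKer M r x = 0 := x.2
    have h' : r • (x : M) = 0 := congrArg Subtype.val h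
    exact Subtype.ext h'

lemma annihilator_le_annihilator_quotient_range_lsmul :
    Module.annihilator R M ≤
      Module.annihilator R (M ⧸ LinearMap.range (LinearMap.lsmul R M r)) :=
  LinearMap.annihilator_le_of_surjective _ (Submodule.mkQ_surjective _)

lemma mem_annihilator_quotient_range_lsmul :
    r ∈ Module.annihilator R (M ⧸ LinearMap.range (LinearMap.lsmul R M r)) := by
  refine Module.mem_annihilator.2 fun x => ?_
  obtain ⟨x, rfl⟩ := Submodule.mkQ_surjective _ x
  rw [← map_smul]
  exact (Submodule.Quotient.mk_eq_zero _).2 ⟨x, rfl⟩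

end Smul

lemma smul_eq_zero_of_mem_annihilator {X Y : ModuleCat.{u} R} {m : ℕ} {r : R}
    (hr : r ∈ Module.annihilator R X) (e : Ext X Y m) : r • e = 0 := by
  have h : r • 𝟙 X = 0 := by
    ext x
    exact Module.mem_annihilator.1 hr x
  rw [← Ext.mk₀_id_comp e, ← Ext.smul_comp, Ext.smul_eq_comp_mk₀, Ext.mk₀_comp_mk₀, h,
    comp_zero, Ext.mk₀_zero, Ext.zero_comp]

lemma comp_mk₀_smul_eq_zero {X Y Z : ModuleCat.{u} R} {m : ℕ} {r : R}
    (hr : r ∈ Module.annihilator R Z) (e : Ext X Y m) (g : Y ⟶ Z) :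
    (r • e).comp (Ext.mk₀ g) (add_zero m) = 0 := by
  have h : r • 𝟙 Z = 0 := by
    ext x
    exact Module.mem_annihilator.1 hr x
  rw [Ext.smul_comp, Ext.smul_eq_comp_mk₀, h, Ext.mk₀_zero, Ext.comp_zero]

/-- Local cohomology with support in an ideal that is, modulo the annihilator of `M` and up to
radical, generated by `k` elements vanishes above degree `k`. -/
lemma ExtVanishes.of_le_radical [IsNoetherianRing R] {ι : Type*} (f : ι → R) (σ : Finset ι)
    (hf : ∀ i ∈ σ, f i ∈ I) (M : Type u) [AddCommGroup M] [Module R M] [Module.Finite R M]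
    (hI : I ≤ (Ideal.span (f '' σ) ⊔ Module.annihilator R M).radical) {m : ℕ} (hm : σ.card ≤ m) :
    ExtVanishes I (m + 1) (ModuleCat.of R M) := by
  classical
  induction σ using Finset.induction_on generalizing M m with
  | empty =>
    obtain ⟨k, hk⟩ := Ideal.exists_pow_le_of_le_radical_of_fg hI (IsNoetherian.noetherian I)
    exact .of_pow_le_annihilator (k := k) (by simpa using hk) m
  | insert a σ ha ih =>
    rw [Finset.card_insert_of_notMem ha] at hm
    obtain ⟨m, rfl⟩ : ∃ l, m = l + 1 := ⟨m - 1, by lia⟩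
    intro t e
    have hrad (N : Type u) [AddCommGroup N] [Module R N]
        (h : Module.annihilator R M ≤ Module.annihilator R N)
        (h' : f a ^ t ∈ Module.annihilator R N) :
        I ≤ (Ideal.span (f '' σ) ⊔ Module.annihilator R N).radical := by
      refine hI.trans (Ideal.radical_le_radical_iff.2 (sup_le (Ideal.span_le.2 ?_)
        ((h.trans le_sup_right).trans Ideal.le_radical)))
      rintro _ ⟨i, hi, rfl⟩
      obtain rfl | hi := Finset.mem_insert.1 hi
      · exact ⟨t, Ideal.mem_sup_right h'⟩
      · exact Ideal.le_radical (Ideal.mem_sup_left (Ideal.subset_span ⟨i, hi, rfl⟩))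
    have hσ : ∀ i ∈ σ, f i ∈ I := fun i hi => hf i (Finset.mem_insert_of_mem hi)
    refine exists_res_eq_zero_of_smul_eq_zero (r := f a ^ t)
      (ih hσ _ (hrad _ (annihilator_le_annihilator_quotient_range_lsmul M _)
        (mem_annihilator_quotient_range_lsmul M _)) (by lia))
      (ih hσ _ (hrad _ (annihilator_le_annihilator_ker_smulToKer M _)
        (mem_annihilator_ker_smulToKer M _)) (by lia)) e
      (smul_eq_zero_of_mem_annihilator ?_ e)
    exact (Ideal.annihilator_quotient (I := I ^ t)).ge
      (Ideal.pow_mem_pow (hf a (Finset.mem_insert_self _ _)) t)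

lemma exists_extVanishes [IsNoetherianRing R] (I : Ideal R) :
    ∃ d : ℕ, ∀ m ≥ d, ∀ (M : Type u) [AddCommGroup M] [Module R M] [Module.Finite R M],
      ExtVanishes I m (ModuleCat.of R M) := by
  obtain ⟨σ, rfl⟩ := IsNoetherian.noetherian I
  refine ⟨σ.card + 1, fun m hm M _ _ _ => ?_⟩
  obtain ⟨m, rfl⟩ : ∃ l, m = l + 1 := ⟨m - 1, by lia⟩
  exact .of_le_radical id σ (fun i hi => Ideal.subset_span hi) M
    (by simpa using le_sup_left.trans Ideal.le_radical) (by lia)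

lemma ExtVanishes.of_le_annihilator [IsNoetherianRing R] {b : Ideal R} {k : ℕ}
    (hb : ∀ j ≥ k, ExtVanishes I j (ModuleCat.of R (R ⧸ b))) (M : Type u) [AddCommGroup M]
    [Module R M] [hM : Module.Finite R M] (hbM : b ≤ Module.annihilator R M) {j : ℕ}
    (hj : k ≤ j) : ExtVanishes I j (ModuleCat.of R M) := by
  obtain ⟨d, hd⟩ := exists_extVanishes I
  obtain ⟨c, hc⟩ : ∃ c, d ≤ j + c := ⟨d, by lia⟩
  induction c generalizing j M with
  | zero => exact hd _ hc M
  | succ c ih =>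
    induction hM using IsNoetherianRing.induction_on_isQuotientEquivQuotientPrime R with
    | subsingleton N => exact .of_subsingleton I j _
    | quotient N p e =>
      let π : (R ⧸ b) →ₗ[R] N := b.liftQ (LinearMap.toSpanSingleton R N (e.symm 1)) fun x hx =>
        Module.mem_annihilator.1 (hbM hx) _
      have hπ : Function.Surjective π := by
        intro y
        obtain ⟨x, hx⟩ := Ideal.Quotient.mk_surjective (e y)
        refine ⟨Submodule.Quotient.mk x, e.injective ?_⟩
        change e (x • e.symm 1) = e y
        rw [map_smul, e.apply_symm_apply, ← hx, Algebra.smul_def, mul_one]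
        rfl
      refine ExtVanishes.right (LinearMap.shortExact_shortComplexKer hπ) (hb j hj)
        (ih _ ?_ (by lia) (by lia))
      exact Ideal.annihilator_quotient.ge.trans
        (LinearMap.annihilator_le_of_injective _ (Submodule.injective_subtype _))
    | exact N₁ N₂ N₃ f g hf hg hfg h₁ h₃ =>
      exact ExtVanishes.middle (S := ModuleCat.shortComplexOfCompEqZero f g
          hfg.linearMap_comp_eq_zero) (ModuleCat.shortComplex_shortExact _ hfg hf hg)
        (h₁ (hbM.trans (LinearMap.annihilator_le_of_injective f hf)))
        (h₃ (hbM.trans (LinearMap.annihilator_le_of_surjective g hg)))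

end localCohomology

namespace localCohomology
open CategoryTheory.Abelian
universe u
variable {R : Type u} [CommRing R] {I : Ideal R}

lemma le_radical_of_extVanishes_one [IsLocalRing R] [IsNoetherianRing R] (hI : I ≠ ⊤)
    {b : Ideal R} (h : ∀ (M : Type u) [AddCommGroup M] [Module R M] [Module.Finite R M],
      b ≤ Module.annihilator R M → ExtVanishes I 1 (ModuleCat.of R M)) :
    I ≤ b.radical := by
  rw [Ideal.radical_eq_sInf]
  refine le_sInf fun p ⟨hbp, hp⟩ x hxI => ?_
  by_contra hxp
  let π : (R ⧸ p) →ₗ[R] (R ⧸ (p ⊔ I)) := Submodule.mapQ _ _ LinearMap.id le_sup_left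
  have hπ : Function.Surjective π := by
    intro y
    obtain ⟨y, rfl⟩ := Submodule.mkQ_surjective _ y
    exact ⟨Submodule.Quotient.mk y, rfl⟩
  have hV : ExtVanishes I (0 + 1) π.shortComplexKer.X₁ :=
    h _ (hbp.trans (Ideal.annihilator_quotient.ge.trans
      (LinearMap.annihilator_le_of_injective _ (Submodule.injective_subtype _))))
  let q : ModuleCat.of R (R ⧸ I ^ 1) ⟶ ModuleCat.of R (R ⧸ (p ⊔ I)) :=
    ModuleCat.ofHom (Submodule.mapQ _ _ LinearMap.id
      ((Ideal.pow_le_self one_ne_zero).trans le_sup_right))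
  obtain ⟨s, hs, e, he⟩ := exists_res_eq_comp_g (LinearMap.shortExact_shortComplexKer hπ) hV
    (Ext.mk₀ q)
  obtain ⟨g, rfl⟩ := Ext.homEquiv₀.symm.surjective e
  have hg : g = 0 := by
    ext
    have h1 : x ^ s • g.hom (Submodule.Quotient.mk 1) = 0 := by
      rw [← map_smul]
      refine (congrArg g.hom ((Submodule.Quotient.mk_eq_zero _).2 ?_)).trans (map_zero _)
      simpa using Ideal.pow_mem_pow hxI s
    obtain ⟨y, hy⟩ := Submodule.mkQ_surjective p (g.hom (Submodule.Quotient.mk 1))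
    have h2 : x ^ s * y ∈ p := by
      rw [← hy] at h1
      exact (Submodule.Quotient.mk_eq_zero _).1 h1
    have h3 : y ∈ p := (hp.mem_or_mem h2).resolve_left fun h => hxp (hp.mem_of_pow_mem _ h)
    exact hy.symm.trans ((Submodule.Quotient.mk_eq_zero _).2 h3)
  have h0 : powProj I hs ≫ q = 0 := by
    apply Ext.homEquiv₀.symm.injective
    refine ((Ext.mk₀_comp_mk₀ _ _).symm.trans he.symm).trans ?_
    rw [hg]
    exact (Ext.mk₀_comp_mk₀ _ _).trans (congrArg Ext.mk₀ zero_comp)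
  have h1 : (1 : R) ∈ p ⊔ I :=
    (Submodule.Quotient.mk_eq_zero _).1 (congrArg (fun t => t.hom (Submodule.Quotient.mk 1)) h0)
  have h2 : p ⊔ I ≤ IsLocalRing.maximalIdeal R :=
    sup_le (IsLocalRing.le_maximalIdeal hp.ne_top) (IsLocalRing.le_maximalIdeal hI)
  exact (Ideal.ne_top_iff_one _).1 Ideal.IsPrime.ne_top' (h2 h1)

/-- The ideal generated by the first `k` members of the family `f`. -/
def initialIdeal {n : ℕ} (f : Fin n → R) (k : ℕ) : Ideal R :=
  Ideal.span (f '' {j | j.val < k})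

lemma ExtVanishes.of_surjective [IsNoetherianRing R] {n : ℕ} {f : Fin n → R}
    (hR : ∀ j ≥ n + 1, ExtVanishes I j (ModuleCat.of R R))
    (hsurj : ∀ (i : Fin n) (t : ℕ)
      (e : Ext (ModuleCat.of R (R ⧸ I ^ t)) (ModuleCat.of R (R ⧸ initialIdeal f i)) (n - i)),
      ∃ (s : ℕ) (h : t ≤ s) (e' : Ext (ModuleCat.of R (R ⧸ I ^ s))
        (ModuleCat.of R (R ⧸ initialIdeal f i)) (n - i)), res I h e = f i • e')
    {k : ℕ} (hk : k ≤ n) (M : Type u) [AddCommGroup M] [Module R M] [Module.Finite R M]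
    (hM : initialIdeal f k ≤ Module.annihilator R M) {j : ℕ} (hj : n + 1 - k ≤ j) :
    ExtVanishes I j (ModuleCat.of R M) := by
  induction k generalizing M j with
  | zero =>
    refine .of_le_annihilator (b := ⊥) (fun j hj => ?_) M bot_le hj
    refine ExtVanishes.right (LinearMap.shortExact_shortComplexKer
      (Submodule.mkQ_surjective (⊥ : Ideal R))) (hR j hj) ?_
    have : Subsingleton (Submodule.mkQ (⊥ : Ideal R)).shortComplexKer.X₁ := by
      change Subsingleton (LinearMap.ker (Submodule.mkQ (⊥ : Ideal R)))
      rw [Submodule.ker_mkQ]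
      infer_instance
    exact .of_subsingleton I _ _
  | succ k ih =>
    have hle : initialIdeal f k ≤ initialIdeal f (k + 1) :=
      Ideal.span_mono (Set.image_mono fun j (hj : j.val < k) => Nat.lt_succ_of_lt hj)
    refine .of_le_annihilator (b := initialIdeal f (k + 1)) (k := n - k) (fun j hj => ?_) M hM
      (by lia)
    obtain hj | rfl := hj.lt_or_eq
    · exact ih (by lia) _ (hle.trans Ideal.annihilator_quotient.ge) (by lia)
    let π : (R ⧸ initialIdeal f k) →ₗ[R] (R ⧸ initialIdeal f (k + 1)) :=
      Submodule.mapQ _ _ LinearMap.id hle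
    have hπ : Function.Surjective π := by
      intro y
      obtain ⟨y, rfl⟩ := Submodule.mkQ_surjective _ y
      exact ⟨Submodule.Quotient.mk y, rfl⟩
    intro t c
    obtain ⟨s, hs, e, he⟩ := exists_res_eq_comp_g (LinearMap.shortExact_shortComplexKer hπ)
      (ih (by lia) _ (Ideal.annihilator_quotient.ge.trans
        (LinearMap.annihilator_le_of_injective _ (Submodule.injective_subtype _))) (by lia)) c
    obtain ⟨s', hs', e', he'⟩ := hsurj ⟨k, hk⟩ s e
    refine ⟨s', hs.trans hs', ?_⟩
    rw [← res_res hs hs', ← he, res_comp, he']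
    refine comp_mk₀_smul_eq_zero (Ideal.annihilator_quotient.ge ?_) _ _
    exact Ideal.subset_span ⟨⟨k, hk⟩, Nat.lt_succ_self k, rfl⟩

lemma exists_res_eq_smul_of_le_radical [IsNoetherianRing R] {n : ℕ} {f : Fin n → R}
    (hf : ∀ i, f i ∈ I) (hI : I ≤ (Ideal.span (Set.range f)).radical) (i : Fin n) {t : ℕ}
    (e : Ext (ModuleCat.of R (R ⧸ I ^ t)) (ModuleCat.of R (R ⧸ initialIdeal f i)) (n - i)) :
    ∃ (s : ℕ) (h : t ≤ s) (e' : Ext (ModuleCat.of R (R ⧸ I ^ s))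
      (ModuleCat.of R (R ⧸ initialIdeal f i)) (n - i)), res I h e = f i • e' := by
  have hV (N : Type u) [AddCommGroup N] [Module R N] [Module.Finite R N]
      (h : initialIdeal f i ≤ Module.annihilator R N) (h' : f i ∈ Module.annihilator R N)
      (m : ℕ) (hm : n - i ≤ m) : ExtVanishes I m (ModuleCat.of R N) := by
    obtain ⟨m, rfl⟩ : ∃ l, m = l + 1 := ⟨m - 1, by lia⟩
    refine .of_le_radical f (Finset.Ioi i) (fun i _ => hf i) N
      (hI.trans (Ideal.radical_mono (Ideal.span_le.2 ?_))) (by rw [Fin.card_Ioi]; lia)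
    rintro _ ⟨j, rfl⟩
    obtain hj | rfl | hj := lt_trichotomy j i
    · exact Ideal.mem_sup_right (h (Ideal.subset_span ⟨j, hj, rfl⟩))
    · exact Ideal.mem_sup_right h'
    · exact Ideal.mem_sup_left (Ideal.subset_span ⟨j, by simpa using hj, rfl⟩)
  exact exists_res_eq_smul
    (hV _ (Ideal.annihilator_quotient.ge.trans
      (annihilator_le_annihilator_quotient_range_lsmul _ _))
      (mem_annihilator_quotient_range_lsmul _ _) _ le_rfl)
    (hV _ (Ideal.annihilator_quotient.ge.trans (annihilator_le_annihilator_ker_smulToKer _ _))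
      (mem_annihilator_ker_smulToKer _ _) _ (by lia)) e

end localCohomology

namespace localCohomology
variable {R : Type} [CommRing R] (I : Ideal R)

open CategoryTheory.Abelian

/-- The functor whose colimit is the local cohomology of `M`. -/
noncomputable def evalDiagram (i : ℕ) (M : ModuleCat.{0} R) : ℕᵒᵖᵒᵖ ⥤ ModuleCat.{0} R :=
  diagram (idealPowersDiagram I) i ⋙ (evaluation _ _).obj M

/-- The colimit cocone defining local cohomology. -/
noncomputable def evalCocone (i : ℕ) (M : ModuleCat.{0} R) : Cocone (evalDiagram I i M) :=
  ((evaluation _ _).obj M).mapCocone (colimit.cocone (diagram (idealPowersDiagram I) i))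

/-- `evalCocone` is a colimit. -/
noncomputable def isColimitEvalCocone (i : ℕ) (M : ModuleCat.{0} R) :
    IsColimit (evalCocone I i M) :=
  isColimitOfPreserves ((evaluation _ _).obj M)
    (colimit.isColimit (diagram (idealPowersDiagram I) i))

/-- The canonical map from `Ext^{i+1}(R / I ^ t, M)` to the local cohomology of `M`. -/
noncomputable def germ (i : ℕ) (M : ModuleCat.{0} R) (t : ℕ) :
    Abelian.Ext (ModuleCat.of R (R ⧸ I ^ t)) M (i + 1) →ₗ[R] (localCohomology I (i + 1)).obj M :=
  ((evalCocone I (i + 1) M).ι.app (op (op t))).hom ∘ₗ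
    (ProjectiveResolution.extIso R (ModuleCat.of R (R ⧸ I ^ t)) M i).symm.toLinearMap

lemma exists_germ_eq (i : ℕ) (M : ModuleCat.{0} R) (x : (localCohomology I (i + 1)).obj M) :
    ∃ (t : ℕ) (e : Abelian.Ext (ModuleCat.of R (R ⧸ I ^ t)) M (i + 1)), germ I i M t e = x := by
  obtain ⟨t, y, hy⟩ := Concrete.isColimit_exists_rep _ (isColimitEvalCocone I (i + 1) M) x
  refine ⟨t.unop.unop, ProjectiveResolution.extIso R _ M i y, ?_⟩
  refine Eq.trans ?_ hy
  exact congrArg _ (LinearEquiv.symm_apply_apply _ _)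

lemma germ_extIso (i : ℕ) (M : ModuleCat.{0} R) (t : ℕ)
    (z : ((_root_.Ext R (ModuleCat.{0} R) (i + 1)).obj
      (op (ModuleCat.of R (R ⧸ I ^ t)))).obj M) :
    germ I i M t (ProjectiveResolution.extIso R _ M i z) =
      (evalCocone I (i + 1) M).ι.app (op (op t)) z :=
  congrArg _ (LinearEquiv.symm_apply_apply _ _)

lemma germ_comp (i : ℕ) (M : ModuleCat.{0} R) {t s : ℕ} (h : t ≤ s)
    (e : Abelian.Ext (ModuleCat.of R (R ⧸ I ^ t)) M (i + 1)) :
    germ I i M s ((Abelian.Ext.mk₀ (powProj I h)).comp e (zero_add _)) = germ I i M t e := by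
  obtain ⟨z, rfl⟩ := (ProjectiveResolution.extIso R (ModuleCat.of R (R ⧸ I ^ t)) M i).surjective e
  rw [← ProjectiveResolution.extIso_naturality, germ_extIso, germ_extIso]
  have h := congrArg (fun t => t.hom z) ((evalCocone I (i + 1) M).w (homOfLE h).op.op)
  exact h

lemma germ_eq_zero_iff (i : ℕ) (M : ModuleCat.{0} R) (t : ℕ)
    (e : Abelian.Ext (ModuleCat.of R (R ⧸ I ^ t)) M (i + 1)) :
    germ I i M t e = 0 ↔ ∃ (s : ℕ) (h : t ≤ s),
      (Abelian.Ext.mk₀ (powProj I h)).comp e (zero_add _) = 0 := by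
  obtain ⟨z, rfl⟩ := (ProjectiveResolution.extIso R (ModuleCat.of R (R ⧸ I ^ t)) M i).surjective e
  constructor
  · intro hz
    rw [germ_extIso] at hz
    have hz' : (evalCocone I (i + 1) M).ι.app (op (op t)) z =
        (evalCocone I (i + 1) M).ι.app (op (op t)) (0 : (evalDiagram I (i + 1) M).obj _) :=
      hz.trans (map_zero ((evalCocone I (i + 1) M).ι.app (op (op t))).hom).symm
    obtain ⟨s, φ, ψ, h⟩ :=
      Concrete.isColimit_exists_of_rep_eq _ (isColimitEvalCocone I (i + 1) M) _ _ hz'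
    refine ⟨s.unop.unop, leOfHom φ.unop.unop, ?_⟩
    rw [← ProjectiveResolution.extIso_naturality]
    refine (congrArg _ (h.trans (map_zero ((evalDiagram I (i + 1) M).map ψ).hom))).trans
      (map_zero _)
  · rintro ⟨s, h, hz⟩
    rw [← germ_comp I i M h, hz, map_zero]

lemma subsingleton_iff_extVanishes (i : ℕ) (M : ModuleCat.{0} R) :
    Subsingleton ((localCohomology I (i + 1)).obj M) ↔ ExtVanishes I (i + 1) M := by
  constructor
  · intro h t e
    exact (germ_eq_zero_iff I i M t e).1 (Subsingleton.elim _ _)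
  · intro h
    refine subsingleton_of_forall_eq 0 fun x => ?_
    obtain ⟨t, e, rfl⟩ := exists_germ_eq I i M x
    exact (germ_eq_zero_iff I i M t e).2 (h t e)

lemma surjective_smul_iff (i : ℕ) (M : ModuleCat.{0} R) (r : R) :
    Function.Surjective (fun x : (localCohomology I (i + 1)).obj M => r • x) ↔
      ∀ (t : ℕ) (e : Ext (ModuleCat.of R (R ⧸ I ^ t)) M (i + 1)),
        ∃ (s : ℕ) (h : t ≤ s) (e' : Ext (ModuleCat.of R (R ⧸ I ^ s)) M (i + 1)),
          res I h e = r • e' := by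
  constructor
  · intro h t e
    obtain ⟨y, hy⟩ := h (germ I i M t e)
    obtain ⟨s, e', rfl⟩ := exists_germ_eq I i M y
    have h₁ : t ≤ max t s := le_max_left _ _
    have h₂ : s ≤ max t s := le_max_right _ _
    have h0 : germ I i M (max t s) (res I h₁ e - r • res I h₂ e') = 0 := by
      rw [map_sub, map_smul]
      exact sub_eq_zero.2 (((germ_comp I i M h₁ e).trans hy.symm).trans
        (congrArg (r • ·) (germ_comp I i M h₂ e').symm))
    obtain ⟨u, hu, hu'⟩ := (germ_eq_zero_iff I i M _ _).1 h0
    refine ⟨u, h₁.trans hu, res I (h₂.trans hu) e', ?_⟩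
    have h3 : res I hu (res I h₁ e - r • res I h₂ e') = 0 := hu'
    rwa [map_sub, map_smul, res_res, res_res, sub_eq_zero] at h3
  · intro h x
    obtain ⟨t, e, rfl⟩ := exists_germ_eq I i M x
    obtain ⟨s, hs, e', he'⟩ := h t e
    refine ⟨germ I i M s e', ?_⟩
    refine (map_smul (germ I i M s) r e').symm.trans ?_
    rw [← he']
    exact germ_comp I i M hs e

end localCohomology

end

/-- Let `(R,m)` be a noetherian local ring, `I` a proper ideal, `n ≥ 1` with
`H^j_I(R) = 0` for all `j ≥ n+1`, and `f_1, …, f_n ∈ I`.  Then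
`√I = √((f_1,…,f_n)R)` iff for each `i = 1, …, n`, multiplication by `f_i` on
`H^{n+1-i}_I(R/(f_1,…,f_{i-1})R)` is surjective.  (Here `i` runs over `Fin n`, so that the
index `i` of the paper corresponds to `i.val + 1` and `n + 1 - (i.val + 1) = n - i.val`.) -/
theorem stmt1 (R : Type) [CommRing R] [IsLocalRing R] [IsNoetherianRing R]
    (I : Ideal R) (hI : I ≠ ⊤) (n : ℕ) (hn : 1 ≤ n)
    (hvanish : ∀ j : ℕ, n + 1 ≤ j → Subsingleton (LocalCohomologyModule I j R))
    (f : Fin n → R) (hf : ∀ i, f i ∈ I) :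
    I.radical = (Ideal.span (Set.range f)).radical ↔
      ∀ i : Fin n,
        Function.Surjective
          (fun x : LocalCohomologyModule I (n - i.val)
              (R ⧸ Ideal.span (f '' {j : Fin n | j < i})) => f i • x) := by
  constructor
  · intro h i
    obtain ⟨m, hm⟩ : ∃ m, n - i.val = m + 1 := ⟨n - i.val - 1, by lia⟩
    have key := fun t => localCohomology.exists_res_eq_smul_of_le_radical hf
      (Ideal.le_radical.trans h.le) i (t := t)
    rw [hm] at key ⊢
    exact (localCohomology.surjective_smul_iff I m _ (f i)).2 key
  · intro h
    refine le_antisymm (Ideal.radical_le_radical_iff.2 ?_) (Ideal.radical_mono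
      (Ideal.span_le.2 (Set.range_subset_iff.2 hf)))
    refine localCohomology.le_radical_of_extVanishes_one hI fun M _ _ _ hM =>
      localCohomology.ExtVanishes.of_surjective (n := n) (f := f) (fun j hj => ?_) (fun i => ?_)
        le_rfl M ((Ideal.span_mono (Set.image_subset_range _ _)).trans hM) (by lia)
    · obtain ⟨j, rfl⟩ : ∃ l, j = l + 1 := ⟨j - 1, by lia⟩
      exact (localCohomology.subsingleton_iff_extVanishes I j _).1 (hvanish _ hj)
    · have key := h i
      obtain ⟨m, hm⟩ : ∃ m, n - i.val = m + 1 := ⟨n - i.val - 1, by lia⟩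
      rw [hm] at key ⊢
      exact (localCohomology.surjective_smul_iff I m _ (f i)).1 key
end

section
/- Let k be a field, n ≥ 1, R = k[[x_1,…,x_n]] the formal power series ring in n variables over k, i ∈ {1,…,n}, and I = (x_1,…,x_i)R. Then the zero ideal of R belongs to Ass_R(D(H^i_I(R))). -/
open IsLocalRing

/-- `E` is an injective hull of the residue field of the local ring `R`. -/
def IsInjectiveHullOfResidueField (R : Type) [CommRing R] [IsLocalRing R]
    (E : Type) [AddCommGroup E] [Module R E] : Prop :=
  Module.Injective R E ∧
    ∃ f : ResidueField R →ₗ[R] E, Function.Injective f ∧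
      ∀ N : Submodule R E, N ≠ ⊥ → N ⊓ LinearMap.range f ≠ ⊥

section

open CategoryTheory Limits Opposite

section
universe v u w z
variable {C : Type u} [Category.{v} C] [Abelian C] [HasProjectiveResolutions C]
  {D : Type z} [Category.{w} D] [Abelian D]

/-- A pair of composable natural transformations with zero composite, applied degreewise to
chain complexes. -/
noncomputable abbrev functorShortComplex {F₁ F₂ F₃ : C ⥤ D}
    [F₁.Additive] [F₂.Additive] [F₃.Additive] (α : F₁ ⟶ F₂) (β : F₂ ⟶ F₃) (h : α ≫ β = 0) :
    ShortComplex (ChainComplex C ℕ ⥤ ChainComplex D ℕ) :=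
  ShortComplex.mk (NatTrans.mapHomologicalComplex α (ComplexShape.down ℕ))
    (NatTrans.mapHomologicalComplex β (ComplexShape.down ℕ)) (by
      ext K i
      exact congr_app h (K.X i))

/-- The connecting maps of left derived functors, natural in the object. -/
theorem exists_leftDerived_connecting {F₁ F₂ F₃ : C ⥤ D} [F₁.Additive] [F₂.Additive] [F₃.Additive]
    (α : F₁ ⟶ F₂) (β : F₂ ⟶ F₃) (h : α ≫ β = 0)
    (hS : ∀ (P : C) [Projective P], (ShortComplex.mk (α.app P) (β.app P)
      (congr_app h P)).ShortExact) (n : ℕ) :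
    ∃ τ : F₃.leftDerived (n + 1) ⟶ F₁.leftDerived n,
      ∀ X, IsZero ((F₂.leftDerived n).obj X) → Epi (τ.app X) := by
  have hP (X : C) : ((functorShortComplex α β h).map
      ((evaluation _ _).obj (projectiveResolution X).complex)).ShortExact :=
    HomologicalComplex.shortExact_of_degreewise_shortExact _ fun i =>
      hS ((projectiveResolution X).complex.X i)
  have hij : (ComplexShape.down ℕ).Rel (n + 1) n := rfl
  let d (X : C) : (HomologicalComplex.homologyFunctor D (ComplexShape.down ℕ) (n + 1)).obj
      ((F₃.mapHomologicalComplex _).obj (projectiveResolution X).complex) ⟶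
      (HomologicalComplex.homologyFunctor D (ComplexShape.down ℕ) n).obj
      ((F₁.mapHomologicalComplex _).obj (projectiveResolution X).complex) :=
    (hP X).δ (n + 1) n hij
  refine ⟨{ app := fun X => ((projectiveResolution X).isoLeftDerivedObj F₃ (n + 1)).hom ≫
              d X ≫ ((projectiveResolution X).isoLeftDerivedObj F₁ n).inv
            naturality := ?_ }, ?_⟩
  · intro X Y f
    let φ := ProjectiveResolution.lift f (projectiveResolution X) (projectiveResolution Y)
    have hφ := ProjectiveResolution.lift_commutes_zero f (projectiveResolution X)
      (projectiveResolution Y)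
    have hd : (HomologicalComplex.homologyFunctor D (ComplexShape.down ℕ) (n + 1)).map
        ((F₃.mapHomologicalComplex _).map φ) ≫ d Y = d X ≫
        (HomologicalComplex.homologyFunctor D (ComplexShape.down ℕ) n).map
        ((F₁.mapHomologicalComplex _).map φ) :=
      (HomologicalComplex.HomologySequence.δ_naturality
        ((functorShortComplex α β h).mapNatTrans ((evaluation _ _).map φ)) (hP X) (hP Y)
        (n + 1) n hij).symm
    rw [ProjectiveResolution.isoLeftDerivedObj_hom_naturality_assoc f _ _ φ hφ,
      Category.assoc, Category.assoc,
      ProjectiveResolution.isoLeftDerivedObj_inv_naturality f _ _ φ hφ]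
    exact congr_arg _ ((reassoc_of% hd) _)
  · intro X hX
    have h0 : IsZero (((functorShortComplex α β h).map
      ((evaluation _ _).obj (projectiveResolution X).complex)).X₂.homology n) :=
      IsZero.of_iso hX ((projectiveResolution X).isoLeftDerivedObj F₂ n).symm
    have : Epi (d X) := (hP X).epi_δ _ _ _ h0
    exact epi_comp' inferInstance (epi_comp' this inferInstance)

theorem isZero_leftDerived_of_smul {R : Type*} [CommRing R] [Linear R C] (F : C ⥤ D)
    [F.Additive] (r : R) (α : F ⟶ F) [IsIso α] (hα : ∀ X, α.app X = F.map (r • 𝟙 X))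
    (X : C) (hX : r • 𝟙 X = 0) (n : ℕ) : IsZero ((F.leftDerived n).obj X) := by
  let P := projectiveResolution X
  have e : (NatTrans.leftDerived α n).app X = (F.leftDerived n).map (r • 𝟙 X) := by
    rw [Functor.leftDerived_map_eq F n (r • 𝟙 X) (P := P) (Q := P) (r • 𝟙 _) (by
      ext
      simp only [HomologicalComplex.comp_f, ChainComplex.single₀_map_f_zero,
        HomologicalComplex.smul_f_apply, Linear.smul_comp,
        Category.id_comp]
      exact ((Linear.comp_smul _ _ _ (P.π.f 0) r (𝟙 X)).trans
        (congr_arg (r • ·) (Category.comp_id (P.π.f 0)))).symm), P.leftDerived_app_eq α n]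
    congr 3
    ext i
    exact hα (P.complex.X i)
  have : IsIso (NatTrans.leftDerived α n) := by
    refine ⟨NatTrans.leftDerived (inv α) n, ?_, ?_⟩ <;> rw [← NatTrans.leftDerived_comp] <;> simp
  rw [hX] at e
  have h0 : (F.leftDerived n).map (0 : X ⟶ X) = 0 := by
    rw [Functor.leftDerived_map_eq F n (0 : X ⟶ X) (P := P) (Q := P) 0 (by simp), Functor.map_zero,
      zero_comp, comp_zero]
  rw [h0] at e
  have : IsIso (0 : (F.leftDerived n).obj X ⟶ (F.leftDerived n).obj X) := by
    rw [← e]; infer_instance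
  exact ((isIsoZero_iff_source_target_isZero _ _).1 this).1
end

section
universe u
variable {R : Type u} [CommRing R]

theorem linearYoneda_shortExact {S : ShortComplex (ModuleCat.{u} R)} (hS : S.ShortExact)
    (P : ModuleCat.{u} R) [Projective P] :
    (ShortComplex.mk (((linearYoneda R _).map S.f).app (op P))
      (((linearYoneda R _).map S.g).app (op P)) (by
        ext (x : P ⟶ S.X₁)
        change (x ≫ S.f) ≫ S.g = 0
        simp)).ShortExact := by
  have := hS.mono_f
  have := hS.epi_g
  refine { exact := ?_, mono_f := ?_, epi_g := ?_ }
  · rw [ShortComplex.moduleCat_exact_iff]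
    intro (x : P ⟶ S.X₂) hx
    exact ⟨hS.exact.lift x hx, hS.exact.lift_f x hx⟩
  · rw [ModuleCat.mono_iff_injective]
    intro (x : P ⟶ S.X₁) (y : P ⟶ S.X₁) (h : x ≫ S.f = y ≫ S.f)
    exact (cancel_mono S.f).1 h
  · rw [ModuleCat.epi_iff_surjective]
    intro (x : P ⟶ S.X₃)
    exact ⟨Projective.factorThru x S.g, Projective.factorThru_comp x S.g⟩

theorem isZero_leftDerived_linearYoneda {X L : ModuleCat.{u} R} (r : R) (hX : r • 𝟙 X = 0)
    [IsIso (r • 𝟙 L)] (n : ℕ) :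
    IsZero ((((linearYoneda R (ModuleCat.{u} R)).obj L).rightOp.leftDerived n).obj X) := by
  have : IsIso (NatTrans.rightOp ((linearYoneda R (ModuleCat.{u} R)).map (r • 𝟙 L))) := by
    refine ⟨NatTrans.rightOp ((linearYoneda R (ModuleCat.{u} R)).map (inv (r • 𝟙 L))), ?_, ?_⟩ <;>
    rw [← NatTrans.rightOp_comp, ← Functor.map_comp]
    · rw [IsIso.inv_hom_id, CategoryTheory.Functor.map_id]; rfl
    · rw [IsIso.hom_inv_id, CategoryTheory.Functor.map_id]; rfl
  refine isZero_leftDerived_of_smul _ r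
    (NatTrans.rightOp ((linearYoneda R (ModuleCat.{u} R)).map (r • 𝟙 L))) (fun Y => ?_) X hX n
  refine Quiver.Hom.unop_inj ?_
  ext (f : Y ⟶ L)
  exact (Linear.comp_smul _ _ _ f r (𝟙 L)).trans
    (((congr_arg (r • ·) (Category.comp_id f)).trans
      (congr_arg (r • ·) (Category.id_comp f)).symm).trans
      (Linear.smul_comp _ _ _ r (𝟙 Y) f).symm)

/-- The connecting map of local cohomology is injective when an element of the ideal acts
invertibly on the middle module. -/
theorem exists_localCohomology_connecting {R : Type} [CommRing R]
    {S : ShortComplex (ModuleCat.{0} R)} (hS : S.ShortExact) (I : Ideal R) (r : R) (hr : r ∈ I)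
    [IsIso (r • 𝟙 S.X₂)] (n : ℕ) :
    ∃ δ : (localCohomology I n).obj S.X₃ ⟶ (localCohomology I (n + 1)).obj S.X₁, Mono δ := by
  obtain ⟨τ, hτ⟩ := exists_leftDerived_connecting
    (NatTrans.rightOp ((linearYoneda R (ModuleCat.{0} R)).map S.g))
    (NatTrans.rightOp ((linearYoneda R (ModuleCat.{0} R)).map S.f))
    (by
      ext X
      refine Quiver.Hom.unop_inj ?_
      ext (f : X ⟶ S.X₁)
      change (f ≫ S.f) ≫ S.g = 0
      simp)
    (fun P _ => (linearYoneda_shortExact hS P).op) n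
  let D := localCohomology.ringModIdeals (localCohomology.idealPowersDiagram I)
  let σ : localCohomology.diagram (localCohomology.idealPowersDiagram I) n ⋙
      (evaluation _ _).obj S.X₃ ⟶
      localCohomology.diagram (localCohomology.idealPowersDiagram I) (n + 1) ⋙
      (evaluation _ _).obj S.X₁ :=
    Functor.whiskerLeft D.op (NatTrans.leftOp τ)
  have hpow (t : ℕ) : IsIso (r ^ t • 𝟙 S.X₂) := by
    induction t with
    | zero => rw [pow_zero, one_smul]; infer_instance
    | succ t ih =>
      have : r ^ (t + 1) • 𝟙 S.X₂ = (r ^ t • 𝟙 S.X₂) ≫ (r • 𝟙 S.X₂) := by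
        rw [Linear.smul_comp, Category.id_comp, smul_smul, pow_succ]
      rw [this]
      infer_instance
  have hσ (t) : Mono (σ.app t) := by
    have : Epi (τ.app (D.obj t.unop)) := by
      refine hτ _ (isZero_leftDerived_linearYoneda (r ^ t.unop.unop) ?_ n)
      ext x
      obtain ⟨a, rfl⟩ := Submodule.Quotient.mk_surjective _ x
      exact (Submodule.Quotient.mk_eq_zero _).2
        (Ideal.mul_mem_right _ _ (Ideal.pow_mem_pow hr _))
    exact inferInstanceAs (Mono (τ.app (D.obj t.unop)).unop)
  have : Mono σ := NatTrans.mono_of_mono_app σ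
  have : Mono (colim.map σ) := inferInstance
  let e (m : ℕ) (M : ModuleCat.{0} R) : (localCohomology I m).obj M ≅
      colim.obj (localCohomology.diagram (localCohomology.idealPowersDiagram I) m ⋙
        (evaluation _ _).obj M) :=
    colimitObjIsoColimitCompEvaluation _ _
  exact ⟨(e n S.X₃).hom ≫ colim.map σ ≫ (e (n + 1) S.X₁).inv, inferInstance⟩

instance preservesFiniteColimits_linearYoneda_rightOp {R : Type u} [CommRing R]
    (M : ModuleCat.{u} R) :
    PreservesFiniteColimits ((linearYoneda R (ModuleCat.{u} R)).obj M).rightOp := by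
  have : PreservesLimits ((linearYoneda R (ModuleCat.{u} R)).obj M ⋙ forget _) :=
    (inferInstance : PreservesLimits (yoneda.obj M))
  have : PreservesLimits ((linearYoneda R (ModuleCat.{u} R)).obj M) :=
    preservesLimits_of_reflects_of_preserves _ (forget _)
  exact preservesFiniteColimits_rightOp _

/-- A module all of whose elements are killed by a power of `I` is a quotient of its zeroth local
cohomology. -/
theorem exists_localCohomology_zero_surjective {R : Type} [CommRing R] (M : ModuleCat.{0} R)
    (I : Ideal R) (hM : ∀ m : M, ∃ t : ℕ, ∀ a ∈ I ^ t, a • m = 0) :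
    ∃ p : (localCohomology I 0).obj M →ₗ[R] M, Function.Surjective p := by
  let D := localCohomology.ringModIdeals (localCohomology.idealPowersDiagram I)
  let F := ((linearYoneda R (ModuleCat.{0} R)).obj M).rightOp
  let G := localCohomology.diagram (localCohomology.idealPowersDiagram I) 0 ⋙ (evaluation _ _).obj M
  let σ : G ⟶ D.op ⋙ F.leftOp :=
    Functor.whiskerLeft D.op (NatTrans.leftOp F.leftDerivedZeroIsoSelf.inv)
  let c : Cocone (D.op ⋙ F.leftOp) :=
    { pt := M
      ι := { app := fun t => ModuleCat.ofHom
               { toFun := fun (f : D.obj t.unop ⟶ M) => f.hom (Ideal.Quotient.mk _ 1)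
                 map_add' := fun _ _ => rfl
                 map_smul' := fun _ _ => rfl }
             naturality := fun _ _ _ => rfl } }
  let e : (localCohomology I 0).obj M ≅ colimit G := colimitObjIsoColimitCompEvaluation _ _
  refine ⟨(e.hom ≫ colimit.desc G ((Cocone.precompose σ).obj c)).hom, fun m => ?_⟩
  obtain ⟨t, ht⟩ := hM m
  let f : ModuleCat.of R (R ⧸ I ^ t) ⟶ M := ModuleCat.ofHom
    (Submodule.liftQ _ (LinearMap.toSpanSingleton R M m) fun a ha => ht a ha)
  let τ : F.leftOp ⟶ (F.leftDerived 0).leftOp := NatTrans.leftOp F.leftDerivedZeroIsoSelf.hom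
  let g : G.obj (op (op t)) := (τ.app (op (D.obj (op t)))).hom f
  refine ⟨e.inv.hom ((colimit.ι G (op (op t))).hom g), ?_⟩
  have h1 : σ.app (op (op t)) g = f := by
    have h := congr_arg Quiver.Hom.unop
      (congr_app F.leftDerivedZeroIsoSelf.inv_hom_id (D.obj (op t)))
    exact congr_arg (fun q => (ModuleCat.Hom.hom q) f) h
  have h2 : colimit.desc G ((Cocone.precompose σ).obj c) (colimit.ι G (op (op t)) g) =
     c.ι.app (op (op t)) (σ.app (op (op t)) g) := by
    rw [← ConcreteCategory.comp_apply, colimit.ι_desc]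
    rfl
  rw [h1] at h2
  have h3 : c.ι.app (op (op t)) f = m := one_smul R m
  rw [h3] at h2
  refine Eq.trans ?_ h2
  have h4 : e.hom.hom (e.inv.hom ((colimit.ι G (op (op t))).hom g)) =
      (colimit.ι G (op (op t))).hom g :=
    congr_arg (fun q => (ModuleCat.Hom.hom q) ((colimit.ι G (op (op t))).hom g)) e.inv_hom_id
  exact congr_arg (colimit.desc G ((Cocone.precompose σ).obj c)).hom h4

end

section
variable {R : Type} [CommRing R] {E : Type} [AddCommGroup E] [Module R E]

/-- The module `H` admits an `R`-linear map to `E` whose annihilator is zero. -/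
def HasFaithfulFunctional (R : Type) [CommRing R] (E : Type) [AddCommGroup E] [Module R E]
    (H : Type) [AddCommGroup H] [Module R H] : Prop :=
  ∃ φ : H →ₗ[R] E, ∀ r : R, (∀ h, φ (r • h) = 0) → r = 0

variable {H H' : Type} [AddCommGroup H] [Module R H] [AddCommGroup H'] [Module R H']

theorem HasFaithfulFunctional.of_injective [Module.Injective R E]
    (h : HasFaithfulFunctional R E H) (f : H →ₗ[R] H') (hf : Function.Injective f) :
    HasFaithfulFunctional R E H' := by
  obtain ⟨φ, hφ⟩ := h
  obtain ⟨ψ, hψ⟩ := Module.Injective.out f hf φ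
  exact ⟨ψ, fun r hr => hφ r fun x => by rw [← hψ, map_smul f]; exact hr _⟩

theorem HasFaithfulFunctional.of_surjective
    (h : HasFaithfulFunctional R E H) (f : H' →ₗ[R] H) (hf : Function.Surjective f) :
    HasFaithfulFunctional R E H' := by
  obtain ⟨φ, hφ⟩ := h
  refine ⟨φ ∘ₗ f, fun r hr => hφ r fun x => ?_⟩
  obtain ⟨y, rfl⟩ := hf x
  simpa using hr y

theorem HasFaithfulFunctional.bot_mem_associatedPrimes [IsDomain R]
    (h : HasFaithfulFunctional R E H) : (⊥ : Ideal R) ∈ associatedPrimes R (H →ₗ[R] E) := by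
  obtain ⟨φ, hφ⟩ := h
  refine ⟨Ideal.isPrime_bot, φ, ?_⟩
  have : Submodule.colon (⊥ : Submodule R (H →ₗ[R] E)) {φ} = ⊥ := by
    rw [eq_bot_iff]
    intro r hr
    rw [Submodule.mem_colon_singleton, Submodule.mem_bot] at hr
    exact hφ r fun x => by simpa using LinearMap.congr_fun hr x
  rw [this]
  exact (Ideal.isPrime_bot.radical).symm

/-- A `k`-linear functional that kills a power of the maximal ideal locally is dominated by an
`R`-linear map to an injective module containing the residue field. -/
theorem exists_linearMap_ker_le_of_residueField [IsLocalRing R] [Module.Injective R E]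
    (f : IsLocalRing.ResidueField R →ₗ[R] E) (hf : Function.Injective f)
    {k : Type} [Field k] [Algebra k R]
    (hk : ∀ r : R, ∃ a : k, r - algebraMap k R a ∈ IsLocalRing.maximalIdeal R)
    (lam : H →+ k) (hlam : ∀ (a : k) (x : H), lam (algebraMap k R a • x) = a * lam x)
    (htors : ∀ x : H, ∃ N : ℕ, ∀ r ∈ IsLocalRing.maximalIdeal R ^ N, lam (r • x) = 0) :
    ∃ φ : H →ₗ[R] E, ∀ x, φ x = 0 → lam x = 0 := by
  let S : Submodule R H :=
    { carrier := {x | ∀ r ∈ IsLocalRing.maximalIdeal R, lam (r • x) = 0}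
      add_mem' := fun {x y} hx hy r hr => by rw [smul_add, map_add, hx r hr, hy r hr, add_zero]
      zero_mem' := fun r _ => by simp
      smul_mem' := fun c x hx r hr => by
        rw [smul_smul]; exact hx _ (Ideal.mul_mem_right _ _ hr) }
  let g : S →ₗ[R] E := f ∘ₗ
    { toFun := fun x => IsLocalRing.residue R (algebraMap k R (lam x))
      map_add' := fun x y => by simp
      map_smul' := fun r x => by
        obtain ⟨a, ha⟩ := hk r
        have h1 : lam (r • (x : H)) = a * lam x := by
          rw [← hlam a x, ← sub_eq_zero, ← map_sub, ← sub_smul]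
          exact x.2 _ ha
        have h2 : IsLocalRing.residue R r = IsLocalRing.residue R (algebraMap k R a) := by
          rw [← sub_eq_zero, ← map_sub]
          exact (IsLocalRing.residue_eq_zero_iff _).2 ha
        rw [Submodule.coe_smul, h1, map_mul, map_mul, ← h2, RingHom.id_apply, Algebra.smul_def]
        rfl }
  obtain ⟨φ, hφ⟩ := Module.Injective.out S.subtype S.injective_subtype g
  refine ⟨φ, fun x hx => ?_⟩
  by_contra hne
  classical
  have hspec := Nat.find_spec (htors x)
  rcases hN : Nat.find (htors x) with _ | N
  · rw [hN] at hspec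
    exact hne (by simpa using hspec 1 (by simp))
  · rw [hN] at hspec
    have := Nat.find_min (htors x) (m := N) (by omega)
    push Not at this
    obtain ⟨r, hr, hrx⟩ := this
    have hS : r • x ∈ S := fun s hs => by
      rw [smul_smul]
      exact hspec _ (by rw [pow_succ']; exact Ideal.mul_mem_mul hs hr)
    have h1 := hφ ⟨r • x, hS⟩
    rw [Submodule.subtype_apply, map_smul, hx, smul_zero] at h1
    have h2 := hf (h1.symm.trans (map_zero f).symm)
    have h3 : (IsLocalRing.residue R).comp (algebraMap k R) (lam (r • x)) = 0 := h2
    exact hrx ((map_eq_zero _).1 h3)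

theorem HasFaithfulFunctional.localCohomology_succ [Module.Injective R E]
    {S : ShortComplex (ModuleCat.{0} R)} (hS : S.ShortExact)
    (I : Ideal R) (r : R) (hr : r ∈ I) (hbij : Function.Bijective fun x : S.X₂ => r • x) (n : ℕ)
    (h : HasFaithfulFunctional R E ((localCohomology I n).obj S.X₃)) :
    HasFaithfulFunctional R E ((localCohomology I (n + 1)).obj S.X₁) := by
  have : IsIso (r • 𝟙 S.X₂) := (ConcreteCategory.isIso_iff_bijective _).2 hbij
  obtain ⟨δ, hδ⟩ := exists_localCohomology_connecting hS I r hr n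
  exact h.of_injective δ.hom ((ModuleCat.mono_iff_injective δ).1 hδ)

theorem HasFaithfulFunctional.localCohomology_congr [Module.Injective R E] (I : Ideal R) (n : ℕ)
    (e : H ≃ₗ[R] H')
    (h : HasFaithfulFunctional R E ((localCohomology I n).obj (ModuleCat.of R H))) :
    HasFaithfulFunctional R E ((localCohomology I n).obj (ModuleCat.of R H')) :=
  h.of_injective ((localCohomology I n).mapIso e.toModuleIso).toLinearEquiv.toLinearMap
    (LinearEquiv.injective _)

end

/-- Hahn series with exponents in `ℤⁿ`, an overring of the power series ring. -/
abbrev LaurentHahn (n : ℕ) (k : Type) [Field k] : Type := HahnSeries (Fin n → ℤ) k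

namespace LaurentHahn

variable {n : ℕ} {k : Type} [Field k]

/-- The inclusion of exponents `ℕⁿ → ℤⁿ`. -/
def exponent (n : ℕ) : (Fin n →₀ ℕ) →+ (Fin n → ℤ) where
  toFun a l := a l
  map_zero' := by ext; simp
  map_add' a b := by ext; simp

@[simp] theorem exponent_apply (a : Fin n →₀ ℕ) (l : Fin n) : exponent n a l = a l := rfl

theorem exponent_injective : Function.Injective (exponent n) := fun a b h => by
  ext l
  exact Nat.cast_injective (R := ℤ) (congr_fun h l)

theorem exponent_le_iff (a b : Fin n →₀ ℕ) : exponent n a ≤ exponent n b ↔ a ≤ b := by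
  simp [Pi.le_def, Finsupp.le_def]

/-- The inclusion of the power series ring in the ring of Hahn series. -/
noncomputable def ofMvPowerSeries (n : ℕ) (k : Type) [Field k] :
    MvPowerSeries (Fin n) k →+* LaurentHahn n k :=
  (HahnSeries.embDomainRingHom (exponent n) exponent_injective exponent_le_iff).comp
    HahnSeries.toMvPowerSeries.symm.toRingHom

noncomputable instance : Algebra (MvPowerSeries (Fin n) k) (LaurentHahn n k) :=
  (ofMvPowerSeries n k).toAlgebra

theorem smul_eq_mul (r : MvPowerSeries (Fin n) k) (v : LaurentHahn n k) :
    r • v = ofMvPowerSeries n k r * v := rfl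

theorem coeff_ofMvPowerSeries (r : MvPowerSeries (Fin n) k) (a : Fin n →₀ ℕ) :
    (ofMvPowerSeries n k r).coeff (exponent n a) = MvPowerSeries.coeff a r :=
  (HahnSeries.embDomain_coeff (f := ⟨⟨exponent n, exponent_injective⟩, exponent_le_iff _ _⟩)).trans
    HahnSeries.coeff_toMvPowerSeries_symm

theorem exists_of_coeff_ofMvPowerSeries_ne_zero {r : MvPowerSeries (Fin n) k} {e : Fin n → ℤ}
    (h : (ofMvPowerSeries n k r).coeff e ≠ 0) :
    ∃ a, exponent n a = e ∧ MvPowerSeries.coeff a r ≠ 0 := by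
  by_cases he : e ∈ Set.range (exponent n)
  · obtain ⟨a, rfl⟩ := he
    exact ⟨a, rfl, by rwa [← coeff_ofMvPowerSeries]⟩
  · exact absurd (HahnSeries.embDomain_of_notMem_range
      (f := ⟨⟨exponent n, exponent_injective⟩, exponent_le_iff _ _⟩) he) h

theorem ofMvPowerSeries_injective : Function.Injective (ofMvPowerSeries n k) := fun r s h => by
  ext a
  rw [← coeff_ofMvPowerSeries, h, coeff_ofMvPowerSeries]

theorem ofMvPowerSeries_algebraMap (a : k) :
    ofMvPowerSeries n k (algebraMap k _ a) = HahnSeries.C a := by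
  ext e
  by_cases he : e ∈ Set.range (exponent n)
  · obtain ⟨b, rfl⟩ := he
    rw [coeff_ofMvPowerSeries, MvPowerSeries.algebraMap_apply, Algebra.algebraMap_self,
      RingHom.id_apply, MvPowerSeries.coeff_C, HahnSeries.C_apply, HahnSeries.coeff_single]
    simp [← (exponent_injective (n := n)).eq_iff]
  · refine (HahnSeries.embDomain_of_notMem_range
      (f := ⟨⟨exponent n, exponent_injective⟩, exponent_le_iff _ _⟩) he).trans ?_
    rw [HahnSeries.C_apply, HahnSeries.coeff_single_of_ne]
    rintro rfl
    exact he ⟨0, map_zero _⟩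

theorem algebraMap_smul (a : k) (v : LaurentHahn n k) :
    algebraMap k (MvPowerSeries (Fin n) k) a • v = a • v := by
  rw [smul_eq_mul, ofMvPowerSeries_algebraMap, HahnSeries.C_mul_eq_smul]

theorem ofMvPowerSeries_X (j : Fin n) :
    ofMvPowerSeries n k (MvPowerSeries.X j) = HahnSeries.single (Pi.single j 1) 1 := by
  have hj : exponent n (Finsupp.single j 1) = Pi.single j 1 := by
    ext l
    by_cases h : l = j
    · subst h; simp
    · simp [h]
  ext e
  by_cases he : e ∈ Set.range (exponent n)
  · obtain ⟨b, rfl⟩ := he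
    rw [coeff_ofMvPowerSeries, MvPowerSeries.coeff_X, ← hj, HahnSeries.coeff_single]
    simp [(exponent_injective (n := n)).eq_iff]
  · refine (HahnSeries.embDomain_of_notMem_range
      (f := ⟨⟨exponent n, exponent_injective⟩, exponent_le_iff _ _⟩) he).trans ?_
    rw [HahnSeries.coeff_single_of_ne]
    rintro rfl
    exact he ⟨_, hj⟩

theorem exists_of_coeff_smul_ne_zero {r : MvPowerSeries (Fin n) k} {v : LaurentHahn n k}
    {e : Fin n → ℤ} (h : (r • v).coeff e ≠ 0) :
    ∃ a e', MvPowerSeries.coeff a r ≠ 0 ∧ v.coeff e' ≠ 0 ∧ exponent n a + e' = e := by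
  obtain ⟨d, hd, e', he', rfl⟩ := Set.mem_add.1
    (HahnSeries.support_mul_subset (x := ofMvPowerSeries n k r) (y := v) h)
  obtain ⟨a, rfl, ha⟩ := exists_of_coeff_ofMvPowerSeries_ne_zero hd
  exact ⟨a, e', ha, he', rfl⟩

theorem coeff_smul_single (r : MvPowerSeries (Fin n) k) (d e : Fin n → ℤ) :
    (r • (HahnSeries.single d 1 : LaurentHahn n k)).coeff e =
      (ofMvPowerSeries n k r).coeff (e - d) := by
  rw [smul_eq_mul, HahnSeries.coeff_mul_single, mul_one]

theorem exists_lower_bound (v : LaurentHahn n k) :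
    ∃ T : ℕ, ∀ e, v.coeff e ≠ 0 → ∀ l, -(T : ℤ) ≤ e l := by
  have h : ∀ l : Fin n, ∃ T : ℕ, ∀ e, v.coeff e ≠ 0 → -(T : ℤ) ≤ e l := by
    intro l
    have hP : ((fun e : Fin n → ℤ => e l) '' v.support).IsPWO :=
      v.isPWO_support.image_of_monotone fun a b hab => hab l
    by_cases hne : ((fun e : Fin n → ℤ => e l) '' v.support).Nonempty
    · refine ⟨(hP.isWF.min hne).natAbs, fun e he => ?_⟩
      have := hP.isWF.min_le hne ⟨e, he, rfl⟩
      simp only at this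
      omega
    · exact ⟨0, fun e he => absurd ⟨_, e, he, rfl⟩ hne⟩
  choose T hT using h
  refine ⟨∑ l, T l, fun e he l => ?_⟩
  have h1 := hT l e he
  have h2 : T l ≤ ∑ l, T l := Finset.single_le_sum (fun _ _ => Nat.zero_le _) (Finset.mem_univ l)
  omega

/-- The Hahn series supported in an upper set of exponents. -/
def supported (k : Type) [Field k] (U : UpperSet (Fin n → ℤ)) :
    Submodule (MvPowerSeries (Fin n) k) (LaurentHahn n k) where
  carrier := {v | ∀ e, v.coeff e ≠ 0 → e ∈ U}
  add_mem' := fun {v w} hv hw e he => by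
    by_contra h
    rw [HahnSeries.coeff_add, not_not.1 (mt (hv e) h), not_not.1 (mt (hw e) h), add_zero] at he
    exact he rfl
  zero_mem' := fun e he => absurd HahnSeries.coeff_zero he
  smul_mem' := fun r v hv e he => by
    obtain ⟨a, e', -, h, rfl⟩ := exists_of_coeff_smul_ne_zero he
    exact U.upper (fun l => by simp) (hv e' h)

theorem supported_mono {U U' : UpperSet (Fin n → ℤ)} (h : U' ≤ U) :
    supported k U ≤ supported k U' := fun _ hv e he => h (hv e he)

/-- The exponents whose coordinates from `j` on are nonnegative. -/
def tailNonneg (n j : ℕ) : UpperSet (Fin n → ℤ) where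
  carrier := {e | ∀ l : Fin n, j ≤ l → 0 ≤ e l}
  upper' := fun _ _ hab ha l hl => (ha l hl).trans (hab l)

/-- The exponents with a nonnegative coordinate before `j`. -/
def someNonneg (n j : ℕ) : UpperSet (Fin n → ℤ) where
  carrier := {e | ∃ l : Fin n, (l : ℕ) < j ∧ 0 ≤ e l}
  upper' := fun _ _ hab ⟨l, hl, h⟩ => ⟨l, hl, h.trans (hab l)⟩

/-- The Hahn series supported in `U` modulo those supported in `U'`. -/
abbrev Quot (k : Type) [Field k] (U U' : UpperSet (Fin n → ℤ)) : Type :=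
  supported k U ⧸ (supported k U').submoduleOf (supported k U)

namespace Quot

variable {U U' U₁ U₁' U₂ U₂' : UpperSet (Fin n → ℤ)}

theorem exists_rep (x : Quot k U U') :
    ∃ v, ∃ hv : v ∈ supported k U, Submodule.Quotient.mk ⟨v, hv⟩ = x := by
  obtain ⟨⟨v, hv⟩, rfl⟩ := Submodule.Quotient.mk_surjective _ x
  exact ⟨v, hv, rfl⟩

theorem mk_eq_zero {v : LaurentHahn n k} (hv : v ∈ supported k U) :
    (Submodule.Quotient.mk ⟨v, hv⟩ : Quot k U U') = 0 ↔ v ∈ supported k U' :=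
  Submodule.Quotient.mk_eq_zero _

/-- The map of quotients induced by inclusions of exponent sets. -/
noncomputable def map (h : U₂ ≤ U₁) (h' : U₂' ≤ U₁') :
    Quot k U₁ U₁' →ₗ[MvPowerSeries (Fin n) k] Quot k U₂ U₂' :=
  Submodule.mapQ _ _ (Submodule.inclusion (supported_mono h)) fun _ hx => supported_mono h' hx

end Quot

/-- The restriction of a Hahn series to the exponents with nonnegative `j`-th coordinate. -/
noncomputable def restrictNonneg (j : Fin n) (v : LaurentHahn n k) : LaurentHahn n k where
  coeff e := if 0 ≤ e j then v.coeff e else 0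
  isPWO_support' := v.isPWO_support.mono fun e he => by
    rw [Function.mem_support] at he
    exact (ite_ne_right_iff.1 he).2

theorem coeff_restrictNonneg (j : Fin n) (v : LaurentHahn n k) (e : Fin n → ℤ) :
    (restrictNonneg j v).coeff e = if 0 ≤ e j then v.coeff e else 0 := rfl

theorem tailNonneg_mono {j j' : ℕ} (h : j ≤ j') : tailNonneg n j' ≤ tailNonneg n j :=
  fun _ he l hl => he l (h.trans hl)

theorem someNonneg_mono {j j' : ℕ} (h : j ≤ j') : someNonneg n j' ≤ someNonneg n j :=
  fun _ ⟨l, hl, he⟩ => ⟨l, hl.trans_le h, he⟩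

/-- A model of the local cohomology of the power series ring supported in the ideal of the
first `j` variables. -/
abbrev Coh (n : ℕ) (k : Type) [Field k] (j : ℕ) : Type :=
  Quot k (tailNonneg n j) (someNonneg n j)

/-- An extension of `Coh n k j` on which the variable of index `j` acts bijectively. -/
abbrev Loc (n : ℕ) (k : Type) [Field k] (j : ℕ) : Type :=
  Quot k (tailNonneg n (j + 1)) (someNonneg n j)

/-- The sequence `0 → Coh n k j → Loc n k j → Coh n k (j + 1) → 0`. -/
noncomputable def cohSequence (n : ℕ) (k : Type) [Field k] (j : Fin n) :
    ShortComplex (ModuleCat.{0} (MvPowerSeries (Fin n) k)) where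
  X₁ := ModuleCat.of _ (Coh n k j)
  X₂ := ModuleCat.of _ (Loc n k j)
  X₃ := ModuleCat.of _ (Coh n k (j + 1))
  f := ModuleCat.ofHom (Quot.map (tailNonneg_mono (Nat.le_succ _)) le_rfl)
  g := ModuleCat.ofHom (Quot.map le_rfl (someNonneg_mono (Nat.le_succ _)))
  zero := by
    ext ⟨v, hv⟩
    exact (Quot.mk_eq_zero _).2 fun e he => ⟨j, Nat.lt_succ_self _, hv e he j le_rfl⟩

theorem cohSequence_shortExact (j : Fin n) : (cohSequence n k j).ShortExact where
  exact := by
    rw [ShortComplex.moduleCat_exact_iff]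
    intro x hx
    obtain ⟨v, hv, rfl⟩ := Quot.exists_rep x
    have hv' : v ∈ supported k (someNonneg n (j + 1)) := (Quot.mk_eq_zero _).1 hx
    have h1 : restrictNonneg j v ∈ supported k (tailNonneg n j) := fun e he l hl => by
      rw [coeff_restrictNonneg, ite_ne_right_iff] at he
      rcases hl.eq_or_lt with h | h
      · exact (Fin.ext h : j = l) ▸ he.1
      · exact hv e he.2 l h
    refine ⟨Submodule.Quotient.mk ⟨_, h1⟩, (Submodule.Quotient.eq _).2 fun e he => ?_⟩
    replace he : (restrictNonneg j v - v).coeff e ≠ 0 := he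
    rw [HahnSeries.coeff_sub, coeff_restrictNonneg] at he
    split_ifs at he with h
    · exact absurd (sub_self _) he
    · obtain ⟨l, hl, hel⟩ := hv' e (fun h0 => he (by rw [h0, sub_zero]))
      refine ⟨l, lt_of_le_of_ne (Nat.le_of_lt_succ hl) fun hlj => h ?_, hel⟩
      exact (Fin.ext hlj : l = j) ▸ hel
  mono_f := by
    rw [ModuleCat.mono_iff_injective, injective_iff_map_eq_zero]
    intro x hx
    obtain ⟨v, hv, rfl⟩ := Quot.exists_rep x
    exact (Quot.mk_eq_zero _).2 ((Quot.mk_eq_zero _).1 hx)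
  epi_g := by
    rw [ModuleCat.epi_iff_surjective]
    intro x
    obtain ⟨v, hv, rfl⟩ := Quot.exists_rep x
    exact ⟨Submodule.Quotient.mk ⟨v, hv⟩, rfl⟩

theorem single_mul_mem_supported {U : UpperSet (Fin n → ℤ)} {d : Fin n → ℤ}
    (hU : ∀ e, e ∈ U → d + e ∈ U) {v : LaurentHahn n k} (hv : v ∈ supported k U) :
    HahnSeries.single d 1 * v ∈ supported k U := fun e he => by
  rw [HahnSeries.coeff_single_mul, one_mul] at he
  simpa using hU _ (hv _ he)

theorem bijective_X_smul (j : Fin n) :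
    Function.Bijective fun x : Loc n k j => (MvPowerSeries.X j : MvPowerSeries (Fin n) k) • x := by
  have hV : ∀ c : ℤ, ∀ e, e ∈ tailNonneg n (j + 1) → Pi.single j c + e ∈ tailNonneg n (j + 1) :=
    fun c e he l hl => by
      have : l ≠ j := fun h => by subst h; omega
      simpa [this] using he l hl
  have hW : ∀ c : ℤ, ∀ e, e ∈ someNonneg n j → Pi.single j c + e ∈ someNonneg n j :=
    fun c e ⟨l, hl, he⟩ => ⟨l, hl, by
      have : l ≠ j := fun h => by subst h; omega
      simpa [this] using he⟩
  have hc : ∀ v : LaurentHahn n k, HahnSeries.single (Pi.single j (-1)) 1 *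
      ((MvPowerSeries.X j : MvPowerSeries (Fin n) k) • v) = v := fun v => by
    rw [smul_eq_mul, ofMvPowerSeries_X, ← mul_assoc, HahnSeries.single_mul_single, ← Pi.single_add]
    simp
  refine ⟨?_, fun x => ?_⟩
  · refine (injective_iff_map_eq_zero
      (DistribSMul.toAddMonoidHom (Loc n k j) (MvPowerSeries.X j : MvPowerSeries (Fin n) k))).2 ?_
    intro x hx
    obtain ⟨v, hv, rfl⟩ := Quot.exists_rep x
    have h := (Quot.mk_eq_zero (Submodule.smul_mem _ _ hv)).1 hx
    rw [Quot.mk_eq_zero, ← hc v]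
    exact single_mul_mem_supported (hW (-1)) h
  · obtain ⟨v, hv, rfl⟩ := Quot.exists_rep x
    refine ⟨Submodule.Quotient.mk ⟨_, single_mul_mem_supported (hV (-1)) hv⟩,
      congr_arg Submodule.Quotient.mk (Subtype.ext ?_)⟩
    refine Eq.trans ?_ (hc v)
    exact mul_left_comm _ _ _

/-- The power series ring is isomorphic to `Coh n k 0`. -/
noncomputable def cohZeroEquiv (n : ℕ) (k : Type) [Field k] :
    MvPowerSeries (Fin n) k ≃ₗ[MvPowerSeries (Fin n) k] Coh n k 0 :=
  LinearEquiv.ofBijective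
    (Submodule.mkQ _ ∘ₗ LinearMap.codRestrict (supported k (tailNonneg n 0))
      (Algebra.linearMap _ _) fun r e he l _ => by
        obtain ⟨a, rfl, -⟩ := exists_of_coeff_ofMvPowerSeries_ne_zero he
        simp)
    (by
      refine ⟨(injective_iff_map_eq_zero _).2 fun r hr => ?_, fun x => ?_⟩
      · have h := (Quot.mk_eq_zero _).1 hr
        refine ofMvPowerSeries_injective (HahnSeries.ext (funext fun e => ?_))
        rw [map_zero, HahnSeries.coeff_zero]
        by_contra he
        obtain ⟨l, hl, -⟩ := h e he
        exact absurd hl (Nat.not_lt_zero _)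
      · obtain ⟨v, hv, rfl⟩ := Quot.exists_rep x
        let r : MvPowerSeries (Fin n) k := fun a => v.coeff (exponent n a)
        refine ⟨r, congr_arg Submodule.Quotient.mk
          (Subtype.ext (HahnSeries.ext (funext fun e => ?_)))⟩
        by_cases he : ∀ l, 0 ≤ e l
        · obtain ⟨a, rfl⟩ : ∃ a, exponent n a = e :=
            ⟨Finsupp.equivFunOnFinite.symm fun l => (e l).toNat, by ext l; simp [he l]⟩
          exact coeff_ofMvPowerSeries r a
        · have h1 : v.coeff e = 0 := by
            by_contra h
            exact he fun l => hv e h l (Nat.zero_le _)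
          refine Eq.trans ?_ h1.symm
          by_contra h
          obtain ⟨a, rfl, -⟩ := exists_of_coeff_ofMvPowerSeries_ne_zero h
          exact he fun l => by simp)

/-- The power series whose monomials have degree at least `t` in the variables of `S`. -/
def orderIdeal (k : Type) [Field k] (S : Finset (Fin n)) (t : ℕ) :
    Ideal (MvPowerSeries (Fin n) k) where
  carrier := {r | ∀ a, MvPowerSeries.coeff a r ≠ 0 → t ≤ ∑ l ∈ S, a l}
  add_mem' := fun {r s} hr hs a ha => by
    by_contra h
    rw [map_add, not_not.1 (mt (hr a) h), not_not.1 (mt (hs a) h), add_zero] at ha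
    exact ha rfl
  zero_mem' := fun a ha => absurd (map_zero _) ha
  smul_mem' := fun c r hr a ha => by
    classical
    rw [_root_.smul_eq_mul, MvPowerSeries.coeff_mul] at ha
    obtain ⟨⟨b, b'⟩, hb, hne⟩ := Finset.exists_ne_zero_of_sum_ne_zero ha
    rw [Finset.HasAntidiagonal.mem_antidiagonal] at hb
    have := hr b' (right_ne_zero_of_mul hne)
    simp only [← hb, Finsupp.add_apply, Finset.sum_add_distrib]
    omega

theorem mem_orderIdeal {S : Finset (Fin n)} {t : ℕ} {r : MvPowerSeries (Fin n) k} :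
    r ∈ orderIdeal k S t ↔ ∀ a, MvPowerSeries.coeff a r ≠ 0 → t ≤ ∑ l ∈ S, a l := Iff.rfl

theorem orderIdeal_mul_le (S : Finset (Fin n)) (t t' : ℕ) :
    orderIdeal k S t * orderIdeal k S t' ≤ orderIdeal k S (t + t') := by
  classical
  refine Ideal.mul_le.2 fun r hr s hs a ha => ?_
  rw [MvPowerSeries.coeff_mul] at ha
  obtain ⟨⟨b, b'⟩, hb, hne⟩ := Finset.exists_ne_zero_of_sum_ne_zero ha
  rw [Finset.HasAntidiagonal.mem_antidiagonal] at hb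
  have h1 := hr b (left_ne_zero_of_mul hne)
  have h2 := hs b' (right_ne_zero_of_mul hne)
  simp only [← hb, Finsupp.add_apply, Finset.sum_add_distrib]
  omega

theorem pow_le_orderIdeal {S : Finset (Fin n)} {J : Ideal (MvPowerSeries (Fin n) k)}
    (hJ : J ≤ orderIdeal k S 1) (t : ℕ) : J ^ t ≤ orderIdeal k S t := by
  induction t with
  | zero => exact fun _ _ _ _ => Nat.zero_le _
  | succ t ih =>
    rw [pow_succ]
    exact (Ideal.mul_mono ih hJ).trans (orderIdeal_mul_le S t 1)

theorem span_X_le_orderIdeal (S : Finset (Fin n)) :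
    Ideal.span ((fun j : Fin n => (MvPowerSeries.X j : MvPowerSeries (Fin n) k)) '' S) ≤
      orderIdeal k S 1 := by
  classical
  rw [Ideal.span_le]
  rintro _ ⟨j, hj, rfl⟩ a ha
  rw [MvPowerSeries.coeff_X, ite_ne_right_iff] at ha
  rw [ha.1]
  calc 1 = Finsupp.single j 1 j := by simp
    _ ≤ _ := Finset.single_le_sum (f := fun l => Finsupp.single j 1 l)
      (fun _ _ => Nat.zero_le _) hj

theorem maximalIdeal_le_orderIdeal :
    IsLocalRing.maximalIdeal (MvPowerSeries (Fin n) k) ≤ orderIdeal k Finset.univ 1 := by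
  intro r hr a ha
  by_contra h
  have h0 : a = 0 := by
    ext l
    have := Finset.single_le_sum (f := fun l => a l) (fun _ _ => Nat.zero_le _) (Finset.mem_univ l)
    simp only [Finsupp.coe_zero, Pi.zero_apply]
    omega
  subst h0
  rw [IsLocalRing.mem_maximalIdeal, mem_nonunits_iff, MvPowerSeries.isUnit_iff_constantCoeff,
    isUnit_iff_ne_zero] at hr
  exact hr ha

theorem exists_sub_algebraMap_mem_maximalIdeal (r : MvPowerSeries (Fin n) k) :
    ∃ a : k, r - algebraMap k _ a ∈ IsLocalRing.maximalIdeal (MvPowerSeries (Fin n) k) := by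
  refine ⟨MvPowerSeries.constantCoeff r, ?_⟩
  rw [IsLocalRing.mem_maximalIdeal, mem_nonunits_iff, MvPowerSeries.isUnit_iff_constantCoeff]
  simp [MvPowerSeries.algebraMap_apply]

theorem Coh.exists_pow_smul_eq_zero (j : ℕ) (x : Coh n k j) :
    ∃ t : ℕ, ∀ r ∈ Ideal.span ((fun l : Fin n => (MvPowerSeries.X l : MvPowerSeries (Fin n) k)) ''
      {l : Fin n | (l : ℕ) < j}) ^ t, r • x = 0 := by
  obtain ⟨v, hv, rfl⟩ := Quot.exists_rep x
  obtain ⟨T, hT⟩ := exists_lower_bound v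
  let S : Finset (Fin n) := Finset.univ.filter fun l => (l : ℕ) < j
  have hS : {l : Fin n | (l : ℕ) < j} = S := by simp [S]
  refine ⟨n * T + 1, fun r hr => ?_⟩
  rw [hS] at hr
  have hr' := mem_orderIdeal.1 (pow_le_orderIdeal (span_X_le_orderIdeal S) _ hr)
  refine (Quot.mk_eq_zero (Submodule.smul_mem _ r hv)).2 fun e he => ?_
  obtain ⟨a, e', ha, he', rfl⟩ := exists_of_coeff_smul_ne_zero he
  by_contra hneg
  have h1 : (n * T + 1 : ℤ) ≤ ∑ l ∈ S, (a l : ℤ) := by exact_mod_cast hr' a ha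
  have h2 : ∑ l ∈ S, (a l : ℤ) ≤ ∑ l ∈ S, (T : ℤ) := by
    refine Finset.sum_le_sum fun l hl => ?_
    have hlj : (l : ℕ) < j := by simpa [S] using hl
    have h3 : ¬ 0 ≤ (exponent n a + e') l := fun h => hneg ⟨l, hlj, h⟩
    have h4 := hT e' he' l
    rw [Pi.add_apply, exponent_apply] at h3
    omega
  have h5 : (S.card : ℤ) ≤ n := by
    exact_mod_cast (Finset.card_le_univ S).trans_eq (Fintype.card_fin n)
  rw [Finset.sum_const, nsmul_eq_mul] at h2
  nlinarith

/-- A sequence of exponents that are negative in the first `j` coordinates. -/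
def path (n j l : ℕ) : Fin n → ℤ := fun c =>
  if (c : ℕ) = 0 then -1 - l else if (c : ℕ) < j then -1 else (l : ℤ) ^ 2

theorem path_zero (hn : 0 < n) (j l : ℕ) : path n j l ⟨0, hn⟩ = -1 - l := if_pos rfl

theorem path_of_le {j : ℕ} (hj : 1 ≤ j) (l : ℕ) {c : Fin n} (hc : j ≤ c) :
    path n j l c = (l : ℤ) ^ 2 := by
  rw [path, if_neg (by omega), if_neg (by omega)]

theorem path_le (j l : ℕ) (c : Fin n) : path n j l c ≤ (l : ℤ) ^ 2 := by
  have := sq_nonneg (l : ℤ)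
  rw [path]
  split_ifs <;> omega

theorem finite_coeff_path (hn : 0 < n) (j : ℕ) (v : LaurentHahn n k) :
    (Function.support fun l => v.coeff (path n j l)).Finite := by
  obtain ⟨T, hT⟩ := exists_lower_bound v
  refine (Set.finite_Iio T).subset fun l hl => ?_
  have := hT _ hl ⟨0, hn⟩
  rw [path_zero] at this
  rw [Set.mem_Iio]
  omega

/-- The sum of the coefficients of a Hahn series along the exponents `path n j`. -/
noncomputable def pathSum (k : Type) [Field k] (hn : 0 < n) (j : ℕ) : LaurentHahn n k →+ k where
  toFun v := ∑ᶠ l : ℕ, v.coeff (path n j l)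
  map_zero' := by simp
  map_add' v w := by
    simp only [HahnSeries.coeff_add]
    exact finsum_add_distrib (finite_coeff_path hn j v) (finite_coeff_path hn j w)

theorem pathSum_apply (hn : 0 < n) (j : ℕ) (v : LaurentHahn n k) :
    pathSum k hn j v = ∑ᶠ l : ℕ, v.coeff (path n j l) := rfl

theorem pathSum_eq_zero (hn : 0 < n) {j : ℕ} {v : LaurentHahn n k}
    (hv : v ∈ supported k (someNonneg n j)) : pathSum k hn j v = 0 := by
  rw [pathSum_apply, ← finsum_zero (α := ℕ)]
  refine finsum_congr fun l => ?_
  by_contra h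
  obtain ⟨c, hc, h0⟩ := hv _ h
  rw [path] at h0
  split_ifs at h0 <;> omega

theorem pathSum_algebraMap_smul (hn : 0 < n) (j : ℕ) (a : k) (v : LaurentHahn n k) :
    pathSum k hn j (algebraMap k (MvPowerSeries (Fin n) k) a • v) = a * pathSum k hn j v := by
  rw [algebraMap_smul, pathSum_apply, pathSum_apply]
  exact (mul_finsum' _ _ (finite_coeff_path hn j v)).symm

theorem pathSum_smul_eq_zero (hn : 0 < n) (j : ℕ) (v : LaurentHahn n k) :
    ∃ N : ℕ, ∀ r ∈ IsLocalRing.maximalIdeal (MvPowerSeries (Fin n) k) ^ N,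
      pathSum k hn j (r • v) = 0 := by
  obtain ⟨T, hT⟩ := exists_lower_bound v
  refine ⟨n * (T ^ 2 + T) + 1, fun r hr => ?_⟩
  have hr' := mem_orderIdeal.1 (pow_le_orderIdeal maximalIdeal_le_orderIdeal _ hr)
  rw [pathSum_apply, ← finsum_zero (α := ℕ)]
  refine finsum_congr fun l => ?_
  by_contra h
  obtain ⟨a, e', ha, he', he⟩ := exists_of_coeff_smul_ne_zero h
  have hl : l ≤ T := by
    have h1 := congr_fun he ⟨0, hn⟩
    have h2 := hT e' he' ⟨0, hn⟩
    rw [path_zero, Pi.add_apply, exponent_apply] at h1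
    omega
  have h1 : ∑ c, a c ≤ ∑ _c : Fin n, (T ^ 2 + T) := by
    refine Finset.sum_le_sum fun c _ => ?_
    have h2 := congr_fun he c
    have h3 := hT e' he' c
    have h4 := path_le j l c
    have h5 : (l : ℤ) ^ 2 ≤ (T : ℤ) ^ 2 := by gcongr
    rw [Pi.add_apply, exponent_apply] at h2
    zify
    omega
  rw [Finset.sum_const, Finset.card_univ, Fintype.card_fin, nsmul_eq_mul, Nat.cast_id] at h1
  have := hr' a ha
  omega

theorem exists_pathSum_smul_ne_zero (hn : 0 < n) {j : ℕ} (hj : 1 ≤ j) (hjn : j ≤ n)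
    {r : MvPowerSeries (Fin n) k} (hr : r ≠ 0) :
    ∃ v ∈ supported k (tailNonneg n j), pathSum k hn j (r • v) ≠ 0 := by
  obtain ⟨b, hb⟩ := (MvPowerSeries.ne_zero_iff_exists_coeff_ne_zero r).1 hr
  obtain ⟨a, ha, hmin⟩ := (measure fun a : Fin n →₀ ℕ => a ⟨0, hn⟩).wf.has_min
    {a | MvPowerSeries.coeff a r ≠ 0} ⟨b, hb⟩
  have hle : ∀ c, a c ≤ ∑ c, a c := fun c =>
    Finset.single_le_sum (f := fun c => a c) (fun _ _ => Nat.zero_le _) (Finset.mem_univ c)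
  obtain ⟨m, hm, hm'⟩ : ∃ m : ℕ, (j = n → m = 0) ∧ (j < n → m = ∑ c, a c + 1) := by
    by_cases h : j = n
    · exact ⟨0, fun _ => rfl, fun h' => absurd h h'.ne⟩
    · exact ⟨_, fun h' => absurd h' h, fun _ => rfl⟩
  refine ⟨HahnSeries.single (path n j m - exponent n a) 1, fun e he c hc => ?_, ?_⟩
  · obtain rfl : e = path n j m - exponent n a := by
      by_contra h
      exact he (HahnSeries.coeff_single_of_ne h)
    have h1 : (a c : ℤ) ≤ ∑ c, a c := by exact_mod_cast hle c
    have h2 : (m : ℤ) = ∑ c, a c + 1 := by exact_mod_cast hm' (hc.trans_lt c.2)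
    rw [Pi.sub_apply, path_of_le hj m hc, exponent_apply]
    nlinarith
  · rw [pathSum_apply, finsum_eq_single _ m]
    · rw [coeff_smul_single, sub_sub_cancel, coeff_ofMvPowerSeries]
      exact ha
    · intro l hl
      rw [coeff_smul_single]
      by_contra h
      obtain ⟨b, hb, hbr⟩ := exists_of_coeff_ofMvPowerSeries_ne_zero h
      have h1 : ¬ b ⟨0, hn⟩ < a ⟨0, hn⟩ := hmin b hbr
      have h2 := congr_fun hb ⟨0, hn⟩
      rw [Pi.sub_apply, Pi.sub_apply, path_zero, path_zero, exponent_apply, exponent_apply] at h2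
      have hlm : l < m := by omega
      have hjn' : j < n := lt_of_le_of_ne hjn fun h => by have := hm h; omega
      have h3 := congr_fun hb ⟨j, hjn'⟩
      rw [Pi.sub_apply, Pi.sub_apply, path_of_le hj _ le_rfl, path_of_le hj _ le_rfl,
        exponent_apply, exponent_apply] at h3
      have h4 : (a ⟨j, hjn'⟩ : ℤ) < m := by
        have := hle ⟨j, hjn'⟩
        have := hm' hjn'
        omega
      have h5 : (l : ℤ) + 1 ≤ m := by exact_mod_cast hlm
      have h6 : (0 : ℤ) ≤ l := Int.natCast_nonneg l
      have h7 : (0 : ℤ) ≤ b ⟨j, hjn'⟩ := Int.natCast_nonneg _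
      nlinarith

/-- The functional on `Coh n k j` induced by `pathSum`. -/
noncomputable def Coh.pathSum (k : Type) [Field k] (hn : 0 < n) (j : ℕ) : Coh n k j →+ k :=
  QuotientAddGroup.lift
    ((supported k (someNonneg n j)).submoduleOf (supported k (tailNonneg n j))).toAddSubgroup
    ((LaurentHahn.pathSum k hn j).comp (supported k (tailNonneg n j)).subtype.toAddMonoidHom)
    fun _ hx => pathSum_eq_zero hn hx

variable {E : Type} [AddCommGroup E] [Module (MvPowerSeries (Fin n) k) E]
  [Module.Injective (MvPowerSeries (Fin n) k) E]

theorem Coh.hasFaithfulFunctional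
    (f : IsLocalRing.ResidueField (MvPowerSeries (Fin n) k) →ₗ[MvPowerSeries (Fin n) k] E)
    (hf : Function.Injective f) {j : ℕ} (hj : 1 ≤ j) (hjn : j ≤ n) :
    HasFaithfulFunctional (MvPowerSeries (Fin n) k) E (Coh n k j) := by
  have hn : 0 < n := hj.trans hjn
  obtain ⟨φ, hφ⟩ := exists_linearMap_ker_le_of_residueField f hf
    exists_sub_algebraMap_mem_maximalIdeal (Coh.pathSum k hn j)
    (fun a x => by
      obtain ⟨v, hv, rfl⟩ := Quot.exists_rep x
      exact pathSum_algebraMap_smul hn j a v)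
    (fun x => by
      obtain ⟨v, hv, rfl⟩ := Quot.exists_rep x
      exact pathSum_smul_eq_zero hn j v)
  refine ⟨φ, fun r hr => ?_⟩
  by_contra hne
  obtain ⟨v, hv, h⟩ := exists_pathSum_smul_ne_zero hn hj hjn hne
  exact h (hφ _ (hr (Submodule.Quotient.mk ⟨v, hv⟩)))

theorem Coh.hasFaithfulFunctional_localCohomology
    (f : IsLocalRing.ResidueField (MvPowerSeries (Fin n) k) →ₗ[MvPowerSeries (Fin n) k] E)
    (hf : Function.Injective f) {i : ℕ} (hi : 1 ≤ i) (hin : i ≤ n) (m : ℕ) :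
    ∀ j, j + m = i → HasFaithfulFunctional (MvPowerSeries (Fin n) k) E
      ((localCohomology (Ideal.span
        ((fun l : Fin n => (MvPowerSeries.X l : MvPowerSeries (Fin n) k)) ''
          {l : Fin n | (l : ℕ) < i})) m).obj (ModuleCat.of _ (Coh n k j))) := by
  induction m with
  | zero =>
    rintro j rfl
    obtain ⟨p, hp⟩ := exists_localCohomology_zero_surjective (ModuleCat.of _ (Coh n k (j + 0))) _
      (Coh.exists_pow_smul_eq_zero (j + 0))
    exact (Coh.hasFaithfulFunctional f hf hi hin).of_surjective p hp
  | succ m ih =>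
    intro j hj
    exact HasFaithfulFunctional.localCohomology_succ
      (cohSequence_shortExact (k := k) (⟨j, by omega⟩ : Fin n)) _
      (MvPowerSeries.X ⟨j, by omega⟩)
      (Ideal.subset_span (Set.mem_image_of_mem _ (show j < i by omega)))
      (bijective_X_smul _) m (ih (j + 1) (by omega))

end LaurentHahn

end

/-- Lemma 2.1.1: Let `k` be a field, `n ≥ 1`, `R = k[[x_1,…,x_n]]`,
`i ∈ {1,…,n}` and `I = (x_1,…,x_i)R`.  Then `{0} ∈ Ass_R(D(H^i_I(R)))`. -/
theorem stmt4 (k : Type) [Field k] (n : ℕ) (hn : 1 ≤ n) (i : ℕ) (hi1 : 1 ≤ i) (hin : i ≤ n)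
    (E : Type) [AddCommGroup E] [Module (MvPowerSeries (Fin n) k) E]
    (hE : IsInjectiveHullOfResidueField (MvPowerSeries (Fin n) k) E) :
    (⊥ : Ideal (MvPowerSeries (Fin n) k)) ∈
      associatedPrimes (MvPowerSeries (Fin n) k)
        (LocalCohomologyModule
            (Ideal.span ((fun j : Fin n => (MvPowerSeries.X j : MvPowerSeries (Fin n) k)) ''
              {j : Fin n | (j : ℕ) < i})) i (MvPowerSeries (Fin n) k) →ₗ[MvPowerSeries (Fin n) k] E) := by
  have : IsDomain (MvPowerSeries (Fin n) k) := NoZeroDivisors.to_isDomain _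
  obtain ⟨hinj, f, hf, -⟩ := hE
  exact ((LaurentHahn.Coh.hasFaithfulFunctional_localCohomology f hf hi1 hin i 0
    (Nat.zero_add i)).localCohomology_congr _ _
      (LaurentHahn.cohZeroEquiv n k).symm).bot_mem_associatedPrimes
end
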